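/- arXiv:2311.09065 — 6 statements merged into one kernel-verified Lean document; each statement's English description precedes it below -/
import Mathlib

section
/- Let m≥1, β>0, z∈ℝ^m with z≥0, and u∈ℝ^m. Then Σ_{i=1}^m |[z_i+β u_i]_+ · u_i| ≤ ‖z‖²/β + (5β/4)·Σ_{i=1}^m ([u_i]_+)². Consequently, if in addition ‖z‖ ≤ B_p and Σ_{i=1}^m ([u_i]_+)² ≤ C_p²/β² for constants B_p, C_p ≥ 0, then Σ_{i=1}^m |[z_i+β u_i]_+ · u_i| ≤ (B_p² + (5/4)C_p²)/β. -/
/-- The scalar form of the complementary slackness bound. -/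
theorem abs_max_add_mul_mul_le {β z : ℝ} (hβ : 0 < β) (hz : 0 ≤ z) (u : ℝ) :
    |max (z + β * u) 0 * u| ≤ z ^ 2 / β + 5 * β / 4 * max u 0 ^ 2 := by
  rw [abs_mul, abs_of_nonneg (le_max_right _ _), ← sub_nonneg]
  refine nonneg_of_mul_nonneg_right (a := β) ?_ hβ
  have hcancel : β * (z ^ 2 / β) = z ^ 2 := by field_simp
  rw [mul_sub, mul_add, hcancel]
  rcases le_total 0 u with hu | hu
  · rw [abs_of_nonneg hu, max_eq_left hu, max_eq_left (by positivity)]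
    nlinarith [sq_nonneg (z - β * u / 2)]
  · rw [abs_of_nonpos hu, max_eq_right hu]
    rcases le_total 0 (z + β * u) with h | h
    · rw [max_eq_left h]
      nlinarith [sq_nonneg (z + 2 * (β * u)), sq_nonneg z]
    · rw [max_eq_right h]
      nlinarith [sq_nonneg z]

/-- Let `m ≥ 1`, `β > 0`, `z ∈ ℝ^m` with `z ≥ 0`, and `u ∈ ℝ^m`. Then
`Σ_{i=1}^m |[z_i + β u_i]_+ · u_i| ≤ ‖z‖²/β + (5β/4)·Σ_{i=1}^m ([u_i]_+)²`
(with `‖z‖² = Σ_i z_i²` the squared Euclidean norm and `[t]_+ := max{t,0}`).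
Consequently, if moreover `‖z‖ ≤ B_p` and `Σ_i ([u_i]_+)² ≤ C_p²/β²` for constants
`B_p, C_p ≥ 0`, then `Σ_i |[z_i + β u_i]_+ · u_i| ≤ (B_p² + (5/4)C_p²)/β`. -/
theorem complementary_slackness_bound
    (m : ℕ) (hm : 1 ≤ m) (β : ℝ) (hβ : 0 < β)
    (z u : Fin m → ℝ) (hz : ∀ i, 0 ≤ z i) :
    (∑ i, |max (z i + β * u i) 0 * u i| ≤
        (∑ i, z i ^ 2) / β + 5 * β / 4 * ∑ i, max (u i) 0 ^ 2) ∧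
    (∀ Bp Cp : ℝ, 0 ≤ Bp → 0 ≤ Cp →
      Real.sqrt (∑ i, z i ^ 2) ≤ Bp →
      (∑ i, max (u i) 0 ^ 2) ≤ Cp ^ 2 / β ^ 2 →
      ∑ i, |max (z i + β * u i) 0 * u i| ≤ (Bp ^ 2 + 5 / 4 * Cp ^ 2) / β) := by
  have hbound : ∑ i, |max (z i + β * u i) 0 * u i| ≤
      (∑ i, z i ^ 2) / β + 5 * β / 4 * ∑ i, max (u i) 0 ^ 2 := by
    rw [Finset.sum_div, Finset.mul_sum, ← Finset.sum_add_distrib]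
    exact Finset.sum_le_sum fun i _ => abs_max_add_mul_mul_le hβ (hz i) (u i)
  refine ⟨hbound, fun Bp Cp hB _ hzB huC => hbound.trans ?_⟩
  calc (∑ i, z i ^ 2) / β + 5 * β / 4 * ∑ i, max (u i) 0 ^ 2
      ≤ Bp ^ 2 / β + 5 * β / 4 * (Cp ^ 2 / β ^ 2) := by
        gcongr
        exact (Real.sqrt_le_left hB).mp hzB
    _ = (Bp ^ 2 + 5 / 4 * Cp ^ 2) / β := by field_simp
end

section
/- Let 0 < β ≤ β′, α ∈ [0, β], z ≥ 0 and g be real numbers, and set z′ := z + α·max{−z/β, g}. Then (β′/2)·([g + z′/β′]_+)² − (β/2)·([g + z/β]_+)² ≤ ((β′−β)/2 + α + α²/(2β′))·([g]_+)² + (α/β′)·z·[g]_+ + ((β′−β)²/(2β²β′))·z². -/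
/-- Let `0 < β ≤ β'`, `α ∈ [0, β]`, `z ≥ 0` and `g` be real numbers, and set
`z' := z + α·max{−z/β, g}`. Then
`(β'/2)·([g + z'/β']_+)² − (β/2)·([g + z/β]_+)²
  ≤ ((β'−β)/2 + α + α²/(2β'))·([g]_+)² + (α/β')·z·[g]_+ + ((β'−β)²/(2β²β'))·z²`,
where `[t]_+ := max{t, 0}`. -/
theorem dual_update_penalty_change_bound
    (β β' α z g z' : ℝ)
    (hβ : 0 < β) (hββ' : β ≤ β') (hα0 : 0 ≤ α) (hαβ : α ≤ β) (hz : 0 ≤ z)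
    (hz' : z' = z + α * max (-z / β) g) :
    β' / 2 * max (g + z' / β') 0 ^ 2 - β / 2 * max (g + z / β) 0 ^ 2 ≤
      ((β' - β) / 2 + α + α ^ 2 / (2 * β')) * max g 0 ^ 2
        + α / β' * z * max g 0
        + (β' - β) ^ 2 / (2 * β ^ 2 * β') * z ^ 2 := by
  have hβ' : 0 < β' := hβ.trans_le hββ'
  obtain ⟨s, rfl⟩ : ∃ s, z = β * s := ⟨z / β, by field_simp⟩
  have hs : 0 ≤ s := nonneg_of_mul_nonneg_right hz hβ
  have hdiv : β * s / β = s := by field_simp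
  have hndiv : -(β * s) / β = -s := by field_simp
  rw [hndiv] at hz'
  rw [hdiv]
  have hlast : (β' - β) ^ 2 / (2 * β ^ 2 * β') * (β * s) ^ 2
      = (β' - β) ^ 2 * s ^ 2 / (2 * β') := by field_simp
  rw [hlast]
  rcases le_or_gt 0 g with hg | hg
  · rw [max_eq_right (by linarith)] at hz'
    have hz'0 : 0 ≤ z' := by rw [hz']; positivity
    rw [max_eq_left (by positivity : 0 ≤ g + z' / β'), max_eq_left (by positivity : 0 ≤ g + s),
      max_eq_left hg, hz', ← sub_nonneg]
    have key : ((β' - β) / 2 + α + α ^ 2 / (2 * β')) * g ^ 2 + α / β' * (β * s) * g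
        + (β' - β) ^ 2 * s ^ 2 / (2 * β')
        - (β' / 2 * (g + (β * s + α * g) / β') ^ 2 - β / 2 * (g + s) ^ 2)
        = (β' - β) * s ^ 2 / 2 := by
      field_simp
      ring
    rw [key]
    have := sub_nonneg.2 hββ'
    positivity
  · rw [max_eq_right hg.le]
    rcases le_or_gt (g + z' / β') 0 with h | h
    · rw [max_eq_right h]
      have : 0 ≤ β / 2 * max (g + s) 0 ^ 2 := by positivity
      have : 0 ≤ (β' - β) ^ 2 * s ^ 2 / (2 * β') := by positivity
      linarith
    · have h' : 0 < g * β' + z' := by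
        have := mul_pos h hβ'
        rwa [add_mul, div_mul_cancel₀ _ hβ'.ne'] at this
      have hgs : -s ≤ g := by
        by_contra! hlt
        rw [max_eq_left hlt.le] at hz'
        nlinarith
      rw [max_eq_right hgs] at hz'
      rw [max_eq_left h.le, max_eq_left (by linarith : 0 ≤ g + s), hz', ← sub_nonneg]
      rw [hz'] at h'
      have key : ((β' - β) / 2 + α + α ^ 2 / (2 * β')) * 0 ^ 2 + α / β' * (β * s) * 0
          + (β' - β) ^ 2 * s ^ 2 / (2 * β')
          - (β' / 2 * (g + (β * s + α * g) / β') ^ 2 - β / 2 * (g + s) ^ 2)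
          = (β' * (β' - β) * ((s + g) * (s - g))
            + 2 * α * (-g * (g * β' + (β * s + α * g))) + α ^ 2 * g ^ 2) / (2 * β') := by
        field_simp
        ring
      rw [key]
      have h1 := sub_nonneg.2 hββ'
      have h2 : 0 ≤ s + g := by linarith
      have h3 : 0 ≤ s - g := by linarith
      have h4 : 0 ≤ -g := by linarith
      positivity
end

section
/- Let (β_k)_{k≥0} be a positive nondecreasing real sequence, (v_k)_{k≥0} nonnegative reals, (α_k)_{k≥0} reals with 0 ≤ α_k ≤ β_k, z⁰ ∈ ℝ^m with z⁰ ≥ 0, and (u^k)_{k≥0} ⊂ ℝ^m, and define z^{k+1} := z^k + α_k·max{−z^k/β_k, u^k} componentwise. Assume for all k≥0: α_k‖[u^k]_+‖ ≤ v_k, ‖[u^k]_+‖ ≤ C_p/β_k, and ‖z^k‖ ≤ B_p, for constants C_p, B_p ≥ 0. Then for every integer K ≥ 1: Σ_{k=0}^{K−1} [ (β_{k+1}/2)‖[u^k + z^{k+1}/β_{k+1}]_+‖² − (β_k/2)‖[u^k + z^k/β_k]_+‖² ] ≤ (C_p² + B_p²)·Σ_{k=0}^{K−1} (β_{k+1}−β_k)/(2β_k²)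 + ((3/2)C_p + B_p)·Σ_{k=0}^{K−1} v_k/β_k. -/
/-- A projected step of length at most `b` from a nonnegative point stays nonnegative. -/
theorem add_mul_max_neg_div_nonneg {b a z u : ℝ} (hb : 0 < b) (ha : 0 ≤ a) (hab : a ≤ b)
    (hz : 0 ≤ z) : 0 ≤ z + a * max (-z / b) u := by
  have h := mul_le_mul_of_nonneg_left (le_max_left (-z / b) u) ha
  have h' : a * (z / b) ≤ z := by
    calc a * (z / b) ≤ b * (z / b) := by gcongr
      _ = z := by field_simp
  rw [neg_div] at h ⊢
  linarith

/-- One-coordinate bound on the increase of the penalty term over one projected step. -/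
theorem penalty_coordinate_step_le {b b' a z u : ℝ} (hb : 0 < b) (hbb : b ≤ b') (ha : 0 ≤ a)
    (hab : a ≤ b) (hz : 0 ≤ z) :
    b' / 2 * max (u + (z + a * max (-z / b) u) / b') 0 ^ 2 - b / 2 * max (u + z / b) 0 ^ 2 ≤
      (b' - b) / 2 * (max u 0 ^ 2 + z ^ 2 / b ^ 2) + 3 / 2 * (a * max u 0 ^ 2)
        + a / b * (z * max u 0) := by
  have hb' : 0 < b' := hb.trans_le hbb
  have hz' := add_mul_max_neg_div_nonneg (u := u) hb ha hab hz
  have hzb : 0 ≤ z / b := by positivity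
  rcases le_total 0 u with hu | hu
  · have hmax : max (-z / b) u = u := max_eq_right (by rw [neg_div]; linarith)
    rw [hmax] at hz' ⊢
    rw [max_eq_left hu, max_eq_left (by positivity), max_eq_left (by positivity)]
    have h₁ : (z + a * u) ^ 2 / (2 * b') ≤ (z + a * u) ^ 2 / (2 * b) := by gcongr
    have h₂ : a ^ 2 * u ^ 2 / (2 * b) ≤ a * u ^ 2 / 2 := by
      rw [div_le_div_iff₀ (by positivity) (by positivity)]
      nlinarith [mul_nonneg (mul_nonneg ha (sq_nonneg u)) (sub_nonneg.2 hab)]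
    have h₃ : 0 ≤ (b' - b) / 2 * (z ^ 2 / b ^ 2) :=
      mul_nonneg (by linarith) (by positivity)
    have e₁ : b' / 2 * (u + (z + a * u) / b') ^ 2
        = b' / 2 * u ^ 2 + u * (z + a * u) + (z + a * u) ^ 2 / (2 * b') := by
      field_simp; ring
    have e₂ : b / 2 * (u + z / b) ^ 2 = b / 2 * u ^ 2 + u * z + z ^ 2 / (2 * b) := by
      field_simp; ring
    have e₃ : (z + a * u) ^ 2 / (2 * b)
        = z ^ 2 / (2 * b) + a / b * (z * u) + a ^ 2 * u ^ 2 / (2 * b) := by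
      field_simp; ring
    rw [e₁, e₂]
    linarith
  · have hstep : z + a * max (-z / b) u ≤ z := by
      have : max (-z / b) u ≤ 0 := max_le (by rw [neg_div]; linarith) hu
      linarith [mul_nonpos_of_nonneg_of_nonpos ha this]
    have h₁ : (z + a * max (-z / b) u) / b' ≤ z / b := by gcongr
    have h₂ : max (u + (z + a * max (-z / b) u) / b') 0 ^ 2 ≤ max (u + z / b) 0 ^ 2 := by
      gcongr
    have h₃ : max (u + z / b) 0 ^ 2 ≤ (z / b) ^ 2 := by
      gcongr
      exact max_le (by linarith) hzb
    rw [max_eq_right hu, ← div_pow]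
    have h₄ := mul_le_mul_of_nonneg_left h₂ (by positivity : 0 ≤ b' / 2)
    have h₅ := mul_le_mul_of_nonneg_left h₃ (by linarith : 0 ≤ (b' - b) / 2)
    linarith


/-- Let `(β_k)` be positive nondecreasing, `(v_k)` nonnegative, `(α_k)` reals
with `0 ≤ α_k ≤ β_k`, `z⁰ ∈ ℝ^m` with `z⁰ ≥ 0`, `(u^k) ⊂ ℝ^m`, and define
`z^{k+1} := z^k + α_k·max{−z^k/β_k, u^k}` componentwise. Assume for all `k ≥ 0`:
`α_k‖[u^k]_+‖ ≤ v_k`, `‖[u^k]_+‖ ≤ C_p/β_k`, and `‖z^k‖ ≤ B_p`, for constants `C_p, B_p ≥ 0`.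
Then for every integer `K ≥ 1`:
`Σ_{k=0}^{K−1} [ (β_{k+1}/2)‖[u^k + z^{k+1}/β_{k+1}]_+‖² − (β_k/2)‖[u^k + z^k/β_k]_+‖² ]
  ≤ (C_p² + B_p²)·Σ_{k=0}^{K−1} (β_{k+1}−β_k)/(2β_k²) + ((3/2)C_p + B_p)·Σ_{k=0}^{K−1} v_k/β_k`.
Here `[a]_+` is the componentwise positive part and all norms are Euclidean
(`‖a‖ = √(Σ_i a_i²)`). -/
theorem cumulative_penalty_term_bound
    (m : ℕ) (β v α : ℕ → ℝ)
    (hβpos : ∀ k, 0 < β k) (hβmono : Monotone β)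
    (hv : ∀ k, 0 ≤ v k) (hα : ∀ k, 0 ≤ α k ∧ α k ≤ β k)
    (z : ℕ → Fin m → ℝ) (u : ℕ → Fin m → ℝ)
    (hz0 : ∀ i, 0 ≤ z 0 i)
    (hzupd : ∀ k, ∀ i, z (k + 1) i = z k i + α k * max (-(z k i) / β k) (u k i))
    (Cp Bp : ℝ) (hCp : 0 ≤ Cp) (hBp : 0 ≤ Bp)
    (h1 : ∀ k, α k * Real.sqrt (∑ i, max (u k i) 0 ^ 2) ≤ v k)
    (h2 : ∀ k, Real.sqrt (∑ i, max (u k i) 0 ^ 2) ≤ Cp / β k)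
    (h3 : ∀ k, Real.sqrt (∑ i, z k i ^ 2) ≤ Bp) :
    ∀ K : ℕ, 1 ≤ K →
      ∑ k ∈ Finset.range K,
          (β (k + 1) / 2 * ∑ i, max (u k i + z (k + 1) i / β (k + 1)) 0 ^ 2
            - β k / 2 * ∑ i, max (u k i + z k i / β k) 0 ^ 2) ≤
        (Cp ^ 2 + Bp ^ 2) * ∑ k ∈ Finset.range K, (β (k + 1) - β k) / (2 * β k ^ 2)
          + (3 / 2 * Cp + Bp) * ∑ k ∈ Finset.range K, v k / β k := by
  intro K _
  have hz : ∀ k i, 0 ≤ z k i := by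
    intro k
    induction k with
    | zero => exact hz0
    | succ k ih =>
      intro i
      rw [hzupd]
      exact add_mul_max_neg_div_nonneg (hβpos k) (hα k).1 (hα k).2 (ih i)
  rw [Finset.mul_sum, Finset.mul_sum, ← Finset.sum_add_distrib]
  refine Finset.sum_le_sum fun k _ => ?_
  have hb := hβpos k
  have hbb : β k ≤ β (k + 1) := hβmono k.le_succ
  obtain ⟨ha, hab⟩ := hα k
  have hsum : β (k + 1) / 2 * ∑ i, max (u k i + z (k + 1) i / β (k + 1)) 0 ^ 2
        - β k / 2 * ∑ i, max (u k i + z k i / β k) 0 ^ 2 ≤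
      (β (k + 1) - β k) / 2 * (∑ i, max (u k i) 0 ^ 2 + (∑ i, z k i ^ 2) / β k ^ 2)
        + 3 / 2 * (α k * ∑ i, max (u k i) 0 ^ 2)
        + α k / β k * ∑ i, z k i * max (u k i) 0 := by
    simp only [Finset.sum_div, ← Finset.sum_add_distrib, ← Finset.sum_sub_distrib,
      Finset.mul_sum]
    refine Finset.sum_le_sum fun i _ => ?_
    rw [hzupd]
    exact penalty_coordinate_step_le hb hbb ha hab (hz k i)
  have hCS := Real.sum_mul_le_sqrt_mul_sqrt Finset.univ (z k) fun i => max (u k i) 0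
  have hP : ∑ i, max (u k i) 0 ^ 2 = √(∑ i, max (u k i) 0 ^ 2) ^ 2 :=
    (Real.sq_sqrt (by positivity)).symm
  have hZ : ∑ i, z k i ^ 2 = √(∑ i, z k i ^ 2) ^ 2 := (Real.sq_sqrt (by positivity)).symm
  have hP0 : 0 ≤ √(∑ i, max (u k i) 0 ^ 2) := Real.sqrt_nonneg _
  have hZ0 : 0 ≤ √(∑ i, z k i ^ 2) := Real.sqrt_nonneg _
  have hP1 := h1 k
  have hP2 := h2 k
  have hZ3 := h3 k
  rw [hP, hZ] at hsum
  set P := √(∑ i, max (u k i) 0 ^ 2)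
  set Z := √(∑ i, z k i ^ 2)
  have hfirst : (β (k + 1) - β k) / 2 * (P ^ 2 + Z ^ 2 / β k ^ 2) ≤
      (β (k + 1) - β k) / 2 * ((Cp / β k) ^ 2 + Bp ^ 2 / β k ^ 2) := by
    have : 0 ≤ (β (k + 1) - β k) / 2 := by linarith
    gcongr
  have hsecond : α k * P ^ 2 ≤ v k * (Cp / β k) := by
    calc α k * P ^ 2 = α k * P * P := by ring
      _ ≤ v k * (Cp / β k) := mul_le_mul hP1 hP2 hP0 (hv k)
  have hthird : α k / β k * ∑ i, z k i * max (u k i) 0 ≤ Bp * (v k / β k) := by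
    calc α k / β k * ∑ i, z k i * max (u k i) 0 ≤ α k / β k * (Z * P) := by gcongr
      _ = Z * (α k * P / β k) := by ring
      _ ≤ Bp * (v k / β k) := by gcongr
  have hfinal : (β (k + 1) - β k) / 2 * ((Cp / β k) ^ 2 + Bp ^ 2 / β k ^ 2)
      + 3 / 2 * (v k * (Cp / β k)) + Bp * (v k / β k) =
      (Cp ^ 2 + Bp ^ 2) * ((β (k + 1) - β k) / (2 * β k ^ 2))
        + (3 / 2 * Cp + Bp) * (v k / β k) := by
    field_simp; ring
  linarith
end

section
/- Let β₀, v₀ > 0, β_k := β₀·√(k+1) for all k ≥ 0, and v_k := v₀/(√(k+1)·(log(k+1))²) for all k ≥ 1. Then for every integer K ≥ 1, Σ_{k=0}^{K−1} v_k/β_k ≤ (v₀/β₀)·(1 + 1/(2(log 2)²) + 1/log 2) ≤ 4v₀/β₀. -/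
/-- The terms of `∑ 1 / (n log² n)` are dominated by the telescoping differences of `1 / log n`. -/
theorem one_div_mul_log_sq_le_sub {x : ℝ} (hx : 1 < x) :
    1 / ((x + 1) * Real.log (x + 1) ^ 2) ≤ 1 / Real.log x - 1 / Real.log (x + 1) := by
  have hx0 : 0 < x := by linarith
  have ha : 0 < Real.log x := Real.log_pos hx
  have hab : Real.log x ≤ Real.log (x + 1) := Real.log_le_log hx0 (by linarith)
  have hb : 0 < Real.log (x + 1) := ha.trans_le hab
  have hdiff : 1 / (x + 1) ≤ Real.log (x + 1) - Real.log x := by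
    have h := Real.one_sub_inv_le_log_of_pos (div_pos (by linarith : 0 < x + 1) hx0)
    rw [Real.log_div (by linarith) hx0.ne'] at h
    convert h using 1
    field_simp
    ring
  calc 1 / ((x + 1) * Real.log (x + 1) ^ 2)
      = 1 / (x + 1) / (Real.log (x + 1) * Real.log (x + 1)) := by
        rw [div_div, sq]
    _ ≤ (Real.log (x + 1) - Real.log x) / (Real.log x * Real.log (x + 1)) := by
        gcongr
    _ = 1 / Real.log x - 1 / Real.log (x + 1) := by
        field_simp

/-- Let `β₀, v₀ > 0`, `β_k := β₀·√(k+1)` for all `k ≥ 0`, `v_0 := v₀`, and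
`v_k := v₀/(√(k+1)·(log(k+1))²)` for all `k ≥ 1`. Then for every integer `K ≥ 1`,
`Σ_{k=0}^{K−1} v_k/β_k ≤ (v₀/β₀)·(1 + 1/(2(log 2)²) + 1/log 2) ≤ 4v₀/β₀`. -/
theorem damped_stepsize_series_bound
    (β₀ v₀ : ℝ) (hβ₀ : 0 < β₀) (hv₀ : 0 < v₀)
    (β v : ℕ → ℝ)
    (hβ : ∀ k : ℕ, β k = β₀ * Real.sqrt (k + 1))
    (hv0 : v 0 = v₀)
    (hv : ∀ k : ℕ, 1 ≤ k → v k = v₀ / (Real.sqrt (k + 1) * Real.log (k + 1) ^ 2)) :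
    ∀ K : ℕ, 1 ≤ K →
      ∑ k ∈ Finset.range K, v k / β k ≤
          v₀ / β₀ * (1 + 1 / (2 * Real.log 2 ^ 2) + 1 / Real.log 2) ∧
        v₀ / β₀ * (1 + 1 / (2 * Real.log 2 ^ 2) + 1 / Real.log 2) ≤ 4 * v₀ / β₀ := by
  have hc : 0 < v₀ / β₀ := div_pos hv₀ hβ₀
  have hlog2 : 0 < Real.log 2 := Real.log_pos one_lt_two
  have hterm0 : v 0 / β 0 = v₀ / β₀ := by simp [hβ, hv0]
  have hterm : ∀ k : ℕ, 1 ≤ k →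
      v k / β k = v₀ / β₀ * (1 / (((k : ℝ) + 1) * Real.log (k + 1) ^ 2)) := by
    intro k hk
    have hsq : Real.sqrt ((k : ℝ) + 1) * Real.sqrt (k + 1) = k + 1 :=
      Real.mul_self_sqrt (by positivity)
    rw [hv k hk, hβ k, div_div, div_mul_div_comm, mul_one]
    congr 1
    linear_combination (β₀ * Real.log (k + 1) ^ 2) * hsq
  have htelescope : ∀ K : ℕ, 2 ≤ K → ∑ k ∈ Finset.range K, v k / β k ≤
      v₀ / β₀ * (1 + 1 / (2 * Real.log 2 ^ 2) + 1 / Real.log 2 - 1 / Real.log K) := by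
    intro K hK
    induction K, hK using Nat.le_induction with
    | base =>
      rw [Finset.sum_range_succ, Finset.sum_range_one, hterm0, hterm 1 le_rfl]
      norm_num [mul_add]
    | succ n hn ih =>
      have hn1 : (1 : ℝ) < n := by exact_mod_cast hn
      rw [Finset.sum_range_succ, hterm n (by omega)]
      have h := mul_le_mul_of_nonneg_left (one_div_mul_log_sq_le_sub hn1) hc.le
      push_cast
      linarith
  intro K hK
  constructor
  · rcases hK.eq_or_lt with rfl | hK2
    · rw [Finset.sum_range_one, hterm0]
      apply le_mul_of_one_le_right hc.le
      have : 0 < 1 / (2 * Real.log 2 ^ 2) + 1 / Real.log 2 := by positivity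
      linarith
    · refine (htelescope K hK2).trans ?_
      gcongr
      have : 0 ≤ 1 / Real.log K := one_div_nonneg.mpr (Real.log_natCast_nonneg K)
      linarith
  · rw [mul_div_assoc, mul_comm 4]
    gcongr
    have hlog : (69 / 100 : ℝ) ≤ Real.log 2 := by linarith [Real.log_two_gt_d9]
    have h1 : 1 / (2 * Real.log 2 ^ 2) ≤ 1 / (2 * (69 / 100 : ℝ) ^ 2) := by gcongr
    have h2 : 1 / Real.log 2 ≤ 1 / (69 / 100 : ℝ) := by gcongr
    norm_num at h1 h2 ⊢
    linarith
end

section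
/- Assume (A1)–(A4) and additionally (A5): f is L_f-smooth on an open set containing X. Fix k, y^k∈ℝⁿ and z^k∈ℝ^m with z^k ≥ 0 and ‖z^k‖ ≤ B_p, and β_k > 0. Then the function f̃^k(x) := L_{β_k}(x; y^k, z^k) + (ρ/2)‖x − x^k‖² − h(x) is convex on X and differentiable with gradient Lipschitz on X with constant L_{f̃^k} = L_f + ρ + √m·L_g·B_p + β_k·(‖AᵀA‖ + m·B_g(B_g + L_g)); moreover h̃^k(x) := h(x) + (ρ/2)‖x − x^k‖² is ρ-strongly convex. -/
open scoped RealInnerProductSpace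

theorem hasDerivAt_max_zero_sq (t : ℝ) :
    HasDerivAt (fun s : ℝ => max s 0 ^ 2) (2 * max t 0) t := by
  rw [hasDerivAt_iff_isLittleO]
  refine Asymptotics.IsBigO.trans_isLittleO (g := fun s => ‖s - t‖ ^ 2) ?_
    (Asymptotics.isLittleO_pow_sub_sub t one_lt_two)
  refine Asymptotics.IsBigO.of_bound 1 (Filter.Eventually.of_forall fun s => ?_)
  rw [norm_pow, norm_norm, one_mul, Real.norm_eq_abs, Real.norm_eq_abs, sq_abs, smul_eq_mul, abs_le]
  rcases max_cases s 0 with ⟨h, h'⟩ | ⟨h, h'⟩ <;> rcases max_cases t 0 with ⟨k, k'⟩ | ⟨k, k'⟩ <;>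
    rw [h, k] <;> constructor <;> nlinarith

section

variable {E F : Type*} [NormedAddCommGroup E] [InnerProductSpace ℝ E]
  [NormedAddCommGroup F] [InnerProductSpace ℝ F]

theorem convexOn_max_zero_sq {s : Set E} {g : E → ℝ} (hg : ConvexOn ℝ s g) (c : ℝ) :
    ConvexOn ℝ s (fun u => max (g u + c) 0 ^ 2) := by
  have := ((hg.add_const c).sup (convexOn_const 0 hg.1)).pow (fun u _ => le_max_right _ _) 2
  exact this

theorem convexOn_sum_of_forall {ι : Type*} [Fintype ι] {s : Set E} (hs : Convex ℝ s)
    {φ : ι → E → ℝ} (hφ : ∀ i, ConvexOn ℝ s (φ i)) : ConvexOn ℝ s (fun u => ∑ i, φ i u) := by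
  refine ⟨hs, fun x hx y hy a b ha hb hab => ?_⟩
  rw [Finset.smul_sum, Finset.smul_sum, ← Finset.sum_add_distrib]
  exact Finset.sum_le_sum fun i _ => (hφ i).2 hx hy ha hb hab

theorem convexOn_half_norm_clm_sub_sq {s : Set E} (hs : Convex ℝ s) (A : E →L[ℝ] F) (b : F) {c : ℝ}
    (hc : 0 ≤ c) : ConvexOn ℝ s (fun u => c / 2 * ‖A u - b‖ ^ 2) := by
  have h1 : ConvexOn ℝ Set.univ (fun u : E => ‖A u - b‖) := by
    have h2 : ConvexOn ℝ Set.univ (fun w : F => ‖w - b‖) := by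
      simpa [dist_eq_norm] using convexOn_univ_dist b
    exact h2.comp_linearMap A.toLinearMap
  exact ((h1.subset (Set.subset_univ _) hs).pow (fun u _ => norm_nonneg _) 2).smul
    (div_nonneg hc two_pos.le)

theorem convexOn_inner_clm_sub {s : Set E} (hs : Convex ℝ s) (A : E →L[ℝ] F) (b y : F) :
    ConvexOn ℝ s (fun u => ⟪y, A u - b⟫) := by
  have := (((innerSL ℝ y).comp A).toLinearMap.convexOn hs).add_const (-⟪y, b⟫)
  refine this.congr fun u _ => ?_
  simp [inner_sub_right, ← sub_eq_add_neg]

theorem convexOn_half_norm_sub_sq_sub {s : Set E} (hs : Convex ℝ s) (c : ℝ) (a : E) :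
    ConvexOn ℝ s (fun u => c / 2 * ‖u - a‖ ^ 2 - c / 2 * ‖u‖ ^ 2) := by
  have := ((innerSL ℝ (-c • a)).toLinearMap.convexOn hs).add_const (c / 2 * ‖a‖ ^ 2)
  refine this.congr fun u _ => ?_
  simp [norm_sub_sq_real, real_inner_comm]
  ring

theorem norm_sum_max_zero_smul_sub_le {ι : Type*} [Fintype ι] {β B L r : ℝ} (hβ : 0 < β)
    (hL : 0 ≤ L) (z p q : ι → ℝ) (P Q : ι → E) (hz : ∀ i, 0 ≤ z i)
    (hp : ∀ i, |p i| ≤ B) (hQ : ∀ i, ‖Q i‖ ≤ B) (hr : 0 ≤ r)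
    (hpq : ∀ i, |p i - q i| ≤ B * r) (hPQ : ∀ i, ‖P i - Q i‖ ≤ L * r) :
    ‖β • ∑ i, max (p i + z i / β) 0 • P i - β • ∑ i, max (q i + z i / β) 0 • Q i‖ ≤
      (√(Fintype.card ι) * L * √(∑ i, z i ^ 2) + β * (Fintype.card ι * B * (B + L))) * r := by
  have key : ∀ i, ‖max (p i + z i / β) 0 • P i - max (q i + z i / β) 0 • Q i‖ ≤
      (B * (B + L) + z i / β * L) * r := by
    intro i
    have hzi : 0 ≤ z i / β := div_nonneg (hz i) hβ.le
    have e : max (p i + z i / β) 0 • P i - max (q i + z i / β) 0 • Q i =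
        max (p i + z i / β) 0 • (P i - Q i) +
          (max (p i + z i / β) 0 - max (q i + z i / β) 0) • Q i := by
      rw [smul_sub, sub_smul]; abel
    have hB : 0 ≤ B := (abs_nonneg _).trans (hp i)
    have h1 : |max (p i + z i / β) 0 - max (q i + z i / β) 0| ≤ B * r := by
      refine (abs_max_sub_max_le_abs _ _ _).trans ?_
      simpa using hpq i
    have h2 : |max (p i + z i / β) 0| ≤ B + z i / β := by
      rw [abs_of_nonneg (le_max_right _ _)]
      exact max_le (by linarith [le_abs_self (p i), hp i]) (by positivity)
    calc _ ≤ |max (p i + z i / β) 0| * ‖P i - Q i‖ +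
          |max (p i + z i / β) 0 - max (q i + z i / β) 0| * ‖Q i‖ := by
          rw [e]; exact (norm_add_le _ _).trans_eq (by simp only [norm_smul, Real.norm_eq_abs])
      _ ≤ (B + z i / β) * (L * r) + B * r * B := by
          gcongr
          exacts [hPQ i, hQ i]
      _ = _ := by ring
  have hsum : ∑ i, z i ≤ √(Fintype.card ι) * √(∑ i, z i ^ 2) := by
    rw [← Real.sqrt_mul (Nat.cast_nonneg _)]
    apply Real.le_sqrt_of_sq_le
    simpa using sq_sum_le_card_mul_sum_sq (s := Finset.univ) (f := z)
  calc _ = β * ‖∑ i, (max (p i + z i / β) 0 • P i - max (q i + z i / β) 0 • Q i)‖ := by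
        rw [← smul_sub, ← Finset.sum_sub_distrib, norm_smul, Real.norm_of_nonneg hβ.le]
    _ ≤ β * ∑ i, (B * (B + L) + z i / β * L) * r := by
        gcongr
        exact norm_sum_le_of_le _ fun i _ => key i
    _ = ((∑ i, z i) * L + β * (Fintype.card ι * B * (B + L))) * r := by
        rw [← Finset.sum_mul, Finset.sum_add_distrib, ← Finset.sum_mul (f := fun i => z i / β),
          ← Finset.sum_div]
        simp only [Finset.sum_const, Finset.card_univ, nsmul_eq_mul]
        field_simp
        ring
    _ ≤ _ := by
        gcongr ?_ * _
        have := mul_le_mul_of_nonneg_right hsum hL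
        linarith

variable [CompleteSpace E]

theorem HasGradientAt.max_zero_sq {g : E → ℝ} {g' x : E} (hg : HasGradientAt g g' x) (c : ℝ) :
    HasGradientAt (fun u => max (g u + c) 0 ^ 2) ((2 * max (g x + c) 0) • g') x := by
  rw [hasGradientAt_iff_hasFDerivAt] at hg ⊢
  rw [map_smul]
  exact (hasDerivAt_max_zero_sq (g x + c)).comp_hasFDerivAt x (hg.add_const c)

theorem hasGradientAt_half_norm_sub_sq (c : ℝ) (a x : E) :
    HasGradientAt (fun u : E => c / 2 * ‖u - a‖ ^ 2) (c • (x - a)) x := by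
  rw [hasGradientAt_iff_hasFDerivAt]
  refine ((((hasFDerivAt_id x).sub_const a).norm_sq).const_mul (c / 2)).congr_fderiv ?_
  ext v
  simp
  ring

variable [CompleteSpace F]

theorem hasGradientAt_half_norm_clm_sub_sq (A : E →L[ℝ] F) (b : F) (c : ℝ) (x : E) :
    HasGradientAt (fun u : E => c / 2 * ‖A u - b‖ ^ 2)
      (c • ContinuousLinearMap.adjoint A (A x - b)) x := by
  rw [hasGradientAt_iff_hasFDerivAt]
  refine ((((A.hasFDerivAt (x := x)).sub_const b).norm_sq).const_mul (c / 2)).congr_fderiv ?_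
  ext v
  simp [ContinuousLinearMap.adjoint_inner_left]
  ring

theorem hasGradientAt_inner_clm_sub (A : E →L[ℝ] F) (b y : F) (x : E) :
    HasGradientAt (fun u : E => ⟪y, A u - b⟫) (ContinuousLinearMap.adjoint A y) x := by
  rw [hasGradientAt_iff_hasFDerivAt]
  refine ((innerSL ℝ y).hasFDerivAt.comp x ((A.hasFDerivAt (x := x)).sub_const b)).congr_fderiv ?_
  ext v
  simp [ContinuousLinearMap.adjoint_inner_left]

end

/-- Under (A1)–(A4) and (A5) (`f` is `L_f`-smooth on an open set containing
`X`), fix `k`, `y^k ∈ ℝⁿ`, `z^k ∈ ℝ^m` with `z^k ≥ 0` and `‖z^k‖ ≤ B_p`, and `β_k > 0`. Then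
`f̃^k(x) := L_{β_k}(x; y^k, z^k) + (ρ/2)‖x − x^k‖² − h(x)` is convex on `X`, differentiable on
an open set containing `X`, with gradient Lipschitz on `X` with constant
`L_{f̃^k} = L_f + ρ + √m·L_g·B_p + β_k·(‖AᵀA‖ + m·B_g(B_g + L_g))`; moreover
`h̃^k(x) := h(x) + (ρ/2)‖x − x^k‖²` is `ρ`-strongly convex (on `X`). -/
theorem smooth_case_subproblem_structure
    (d n m : ℕ) (hm : 0 < m)
    (A : EuclideanSpace ℝ (Fin d) →L[ℝ] EuclideanSpace ℝ (Fin n))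
    (b : EuclideanSpace ℝ (Fin n))
    (f h : EuclideanSpace ℝ (Fin d) → ℝ)
    (g : Fin m → EuclideanSpace ℝ (Fin d) → ℝ)
    (X : Set (EuclideanSpace ℝ (Fin d)))
    -- (A1)
    (hXcomp : IsCompact X) (hXne : X.Nonempty)
    (D : ℝ) (hD : IsGreatest {t | ∃ x₁ ∈ X, ∃ x₂ ∈ X, t = ‖x₁ - x₂‖} D)
    (ρ : ℝ) (hρ : 0 < ρ)
    (hfwc : ConvexOn ℝ X (fun u => f u + ρ / 2 * ‖u‖ ^ 2))
    (hhconv : ConvexOn ℝ X h) (hhlsc : LowerSemicontinuous h)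
    -- (A2)
    (Lg Bg : ℝ) (hBg : 0 < Bg)
    (U : Set (EuclideanSpace ℝ (Fin d))) (hUopen : IsOpen U) (hXU : X ⊆ U)
    (hgconv : ∀ i, ConvexOn ℝ Set.univ (g i))
    (hgdiff : ∀ i, DifferentiableOn ℝ (g i) U)
    (hgsmooth : ∀ i, ∀ u ∈ U, ∀ u' ∈ U, ‖gradient (g i) u - gradient (g i) u'‖ ≤ Lg * ‖u - u'‖)
    (hgbound : ∀ i, ∀ u ∈ X, |g i u| ≤ Bg ∧ ‖gradient (g i) u‖ ≤ Bg)
    (hglip : ∀ i, ∀ u ∈ X, ∀ u' ∈ X, |g i u - g i u'| ≤ Bg * ‖u - u'‖)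
    -- (A3)
    (xfeas : EuclideanSpace ℝ (Fin d)) (hxfeas : xfeas ∈ interior X)
    (hAxfeas : A xfeas = b)
    (gmin : ℝ) (hgminpos : 0 < gmin)
    (hgmin : IsLeast {t | ∃ i, t = -(g i xfeas)} gmin)
    -- (A4)
    (rh : ℝ) (hrh : 0 < rh)
    (hhsubne : ∀ u ∈ X, ∃ ξ : EuclideanSpace ℝ (Fin d), ∀ u' ∈ X, h u + ⟪ξ, u' - u⟫ ≤ h u')
    (hhsub : ∀ u ∈ X, ∀ ξ : EuclideanSpace ℝ (Fin d),
      (∀ u' ∈ X, h u + ⟪ξ, u' - u⟫ ≤ h u') →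
      ∃ w v, ξ = w + v ∧ (∀ u' ∈ X, ⟪w, u' - u⟫ ≤ 0) ∧ ‖v‖ ≤ rh)
    -- (A5)
    (Lf : ℝ) (U' : Set (EuclideanSpace ℝ (Fin d))) (hU'open : IsOpen U') (hXU' : X ⊆ U')
    (hfdiff : DifferentiableOn ℝ f U')
    (hfsmooth : ∀ u ∈ U', ∀ u' ∈ U', ‖gradient f u - gradient f u'‖ ≤ Lf * ‖u - u'‖)
    -- fixed iteration data
    (Bp : ℝ) (xk : EuclideanSpace ℝ (Fin d))
    (yk : EuclideanSpace ℝ (Fin n)) (zk : Fin m → ℝ)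
    (hzk : ∀ i, 0 ≤ zk i) (hzknorm : Real.sqrt (∑ i, zk i ^ 2) ≤ Bp)
    (βk : ℝ) (hβk : 0 < βk)
    (ftil : EuclideanSpace ℝ (Fin d) → ℝ)
    (hftil : ∀ u, ftil u = f u + ⟪yk, A u - b⟫ + βk / 2 * ‖A u - b‖ ^ 2
        + βk / 2 * ∑ i, max (g i u + zk i / βk) 0 ^ 2 - (∑ i, zk i ^ 2) / (2 * βk)
        + ρ / 2 * ‖u - xk‖ ^ 2) :
    ConvexOn ℝ X ftil ∧
    (∃ W : Set (EuclideanSpace ℝ (Fin d)), IsOpen W ∧ X ⊆ W ∧ DifferentiableOn ℝ ftil W) ∧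
    (∀ u ∈ X, ∀ u' ∈ X, ‖gradient ftil u - gradient ftil u'‖ ≤
        (Lf + ρ + Real.sqrt m * Lg * Bp
          + βk * (‖(ContinuousLinearMap.adjoint A).comp A‖ + m * Bg * (Bg + Lg))) * ‖u - u'‖) ∧
    ConvexOn ℝ X (fun u => h u + ρ / 2 * ‖u - xk‖ ^ 2 - ρ / 2 * ‖u‖ ^ 2) := by
  have hXconv : Convex ℝ X := hhconv.1
  have hgrad : ∀ u ∈ U ∩ U', HasGradientAt ftil (gradient f u
      + ContinuousLinearMap.adjoint A yk + βk • ContinuousLinearMap.adjoint A (A u - b)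
      + βk • ∑ i, max (g i u + zk i / βk) 0 • gradient (g i) u + ρ • (u - xk)) u := by
    rintro u ⟨hu, hu'⟩
    have h1 : HasGradientAt f (gradient f u) u :=
      (hfdiff.differentiableAt (hU'open.mem_nhds hu')).hasGradientAt
    have h2 := hasGradientAt_inner_clm_sub A b yk u
    have h3 := hasGradientAt_half_norm_clm_sub_sq A b βk u
    have h4 : ∀ i, HasGradientAt (fun u => max (g i u + zk i / βk) 0 ^ 2) _ u := fun i =>
      (((hgdiff i).differentiableAt (hUopen.mem_nhds hu)).hasGradientAt).max_zero_sq (zk i / βk)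
    have h5 := hasGradientAt_half_norm_sub_sq ρ xk u
    rw [funext hftil]
    simp only [hasGradientAt_iff_hasFDerivAt] at h1 h2 h3 h4 h5 ⊢
    refine (((((h1.add h2).add h3).add ((HasFDerivAt.fun_sum (u := Finset.univ)
      fun i _ => h4 i).const_mul (βk / 2))).sub_const
      ((∑ i, zk i ^ 2) / (2 * βk))).add h5).congr_fderiv ?_
    simp only [map_add, map_smul, map_sum, Finset.smul_sum, smul_smul, ← mul_assoc,
      div_mul_cancel₀ βk (two_ne_zero (α := ℝ))]
  refine ⟨?_, ⟨U ∩ U', hUopen.inter hU'open, Set.subset_inter hXU hXU',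
    fun u hu => (hgrad u hu).differentiableAt.differentiableWithinAt⟩, ?_, ?_⟩
  · have hpen : ConvexOn ℝ X (fun u => βk / 2 * ∑ i, max (g i u + zk i / βk) 0 ^ 2) := by
      refine ConvexOn.smul (half_pos hβk).le ?_
      exact convexOn_sum_of_forall hXconv fun i =>
        convexOn_max_zero_sq ((hgconv i).subset (Set.subset_univ _) hXconv) _
    refine (((((hfwc.add (convexOn_inner_clm_sub hXconv A b yk)).add
      (convexOn_half_norm_clm_sub_sq hXconv A b hβk.le)).add hpen).add_const
      (-((∑ i, zk i ^ 2) / (2 * βk)))).add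
      (convexOn_half_norm_sub_sq_sub hXconv ρ xk)).congr fun u _ => ?_
    simp only [Pi.add_apply, hftil]
    ring
  · intro u hu u' hu'
    rcases eq_or_ne u u' with rfl | hne
    · simp
    have hr : 0 < ‖u - u'‖ := norm_pos_iff.2 (sub_ne_zero.2 hne)
    have hLg : 0 ≤ Lg := nonneg_of_mul_nonneg_left
      ((norm_nonneg _).trans (hgsmooth ⟨0, hm⟩ u (hXU hu) u' (hXU hu'))) hr
    rw [(hgrad u ⟨hXU hu, hXU' hu⟩).gradient, (hgrad u' ⟨hXU hu', hXU' hu'⟩).gradient]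
    have hpen := norm_sum_max_zero_smul_sub_le hβk hLg zk (fun i => g i u) (fun i => g i u')
      (fun i => gradient (g i) u) (fun i => gradient (g i) u') hzk
      (fun i => (hgbound i u hu).1) (fun i => (hgbound i u' hu').2) hr.le
      (fun i => hglip i u hu u' hu') (fun i => hgsmooth i u (hXU hu) u' (hXU hu'))
    rw [Fintype.card_fin] at hpen
    have hz : √m * Lg * √(∑ i, zk i ^ 2) * ‖u - u'‖ ≤ √m * Lg * Bp * ‖u - u'‖ := by gcongr
    have hA := mul_le_mul_of_nonneg_left
      (((ContinuousLinearMap.adjoint A).comp A).le_opNorm (u - u')) hβk.le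
    have e : ∀ a a' y q q' s s' w w' : EuclideanSpace ℝ (Fin d),
        a + y + q + s + w - (a' + y + q' + s' + w') =
          (a - a') + (q - q') + (s - s') + (w - w') := by
      intros; abel
    rw [e]
    have hq : ‖βk • ContinuousLinearMap.adjoint A (A u - b)
        - βk • ContinuousLinearMap.adjoint A (A u' - b)‖ ≤
          βk * (‖(ContinuousLinearMap.adjoint A).comp A‖ * ‖u - u'‖) := by
      rw [← smul_sub, ← map_sub, sub_sub_sub_cancel_right, ← map_sub, norm_smul,
        Real.norm_of_nonneg hβk.le]
      exact hA
    have hw : ‖ρ • (u - xk) - ρ • (u' - xk)‖ = ρ * ‖u - u'‖ := by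
      rw [← smul_sub, sub_sub_sub_cancel_right, norm_smul, Real.norm_of_nonneg hρ.le]
    have hf := hfsmooth u (hXU' hu) u' (hXU' hu')
    refine (norm_add_le _ _).trans ((add_le_add_left norm_add₃_le _).trans ?_)
    linarith
  · refine (hhconv.add (convexOn_half_norm_sub_sq_sub hXconv ρ xk)).congr fun u _ => ?_
    simp only [Pi.add_apply]
    ring
end

section
/- Given ε>0, under Assumptions (A1)–(A5), let {x^k, y^k, z^k} be generated by DPALM with β_k, v_k as in the parameter choice, where each x^{k+1} satisfies dist(0, ∂_x L̃_{β_k}(x^{k+1}; y^k, z^k)) ≤ ε_k := min{ε/8, √(ρ/(2β_k)), 1}, with L̃_{β_k}(x; y, z) := L_{β_k}(x; y, z) + ρ‖x − x^k‖². Then for K₂ := ⌈5 C_x ρ ε⁻²⌉ and any integer K̃₁ ≥ 0: min_{K̃₁ ≤ k ≤ K̃₁+K₂−1} dist(0, ∂_x L_{β_k}(x^{k+1}; y^k, z^k)) ≤ ε. -/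
noncomputable section

open scoped RealInnerProductSpace
open Metric

/-- Convex subdifferential of `φ` relative to the set `X` (the effective domain):
`∂φ(x) = {ξ | ∀ u ∈ X, φ(u) ≥ φ(x) + ⟨ξ, u − x⟩}`. -/
def csubdiff {E : Type*} [NormedAddCommGroup E] [InnerProductSpace ℝ E]
    (X : Set E) (φ : E → ℝ) (x : E) : Set E :=
  {ξ | ∀ u ∈ X, φ x + ⟪ξ, u - x⟫ ≤ φ u}

/-- Subdifferential of a `ρ`-weakly convex function `φ` (relative to the domain `X`):
`∂φ(x) := ∂(φ + (ρ/2)‖·‖²)(x) − ρx`, the latter being the convex subdifferential. -/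
def wsubdiff {E : Type*} [NormedAddCommGroup E] [InnerProductSpace ℝ E]
    (X : Set E) (ρ : ℝ) (φ : E → ℝ) (x : E) : Set E :=
  {ξ | ξ + ρ • x ∈ csubdiff X (fun u => φ u + ρ / 2 * ‖u‖ ^ 2) x}

open Classical in
/-- Moore–Penrose pseudoinverse of a continuous linear map on a real inner product space
(defined via its characterizing equations; `0` if no such map exists). -/
def mpPinv {F : Type*} [NormedAddCommGroup F] [InnerProductSpace ℝ F] [CompleteSpace F]
    (T : F →L[ℝ] F) : F →L[ℝ] F :=
  if hT : ∃ S : F →L[ℝ] F,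
      T.comp (S.comp T) = T ∧ S.comp (T.comp S) = S ∧
      ContinuousLinearMap.adjoint (T.comp S) = T.comp S ∧
      ContinuousLinearMap.adjoint (S.comp T) = S.comp T
  then hT.choose else 0

section Subgradients

variable {E F : Type*} [NormedAddCommGroup E] [InnerProductSpace ℝ E]
  [NormedAddCommGroup F] [InnerProductSpace ℝ F]

/-- If the restriction of `φ` to a ray lies above a concave quadratic that touches it at the base
point, then the slope of the quadratic is at most the directional derivative of `φ`. -/
theorem le_fderiv_of_quadratic_minorant {φ : E → ℝ} {φ' : E →L[ℝ] ℝ} {x v : E} {a c : ℝ}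
    (hφ : HasFDerivAt φ φ' x)
    (hmin : ∀ t : ℝ, 0 < t → t ≤ 1 → φ x + t * a - c * t ^ 2 ≤ φ (x + t • v)) :
    a ≤ φ' v := by
  have hline : HasDerivAt (fun t : ℝ => φ (x + t • v)) (φ' v) 0 := by
    have h := hφ.hasLineDerivAt v
    exact h
  have hslope := hline.tendsto_slope_zero_right
  have hlim : Filter.Tendsto (fun t : ℝ => a - c * t) (nhdsWithin 0 (Set.Ioi 0)) (nhds a) := by
    have : Filter.Tendsto (fun t : ℝ => a - c * t) (nhds 0) (nhds (a - c * 0)) :=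
      (Continuous.tendsto (by fun_prop) 0)
    simpa using this.mono_left nhdsWithin_le_nhds
  refine le_of_tendsto_of_tendsto hlim hslope ?_
  filter_upwards [Ioc_mem_nhdsGT (show (0 : ℝ) < 1 by norm_num)] with t ht
  have h := hmin t ht.1 ht.2
  simp only [zero_add, zero_smul, add_zero, smul_eq_mul]
  rw [inv_mul_eq_div, le_div_iff₀ ht.1]
  nlinarith

/-- The gradient inequality for a convex function. -/
theorem ConvexOn.add_fderiv_le {S : Set E} {φ : E → ℝ} {φ' : E →L[ℝ] ℝ} {x u : E}
    (hconv : ConvexOn ℝ S φ) (hx : x ∈ S) (hu : u ∈ S) (hφ : HasFDerivAt φ φ' x) :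
    φ x + φ' (u - x) ≤ φ u := by
  have key : -(φ u - φ x) ≤ (-φ') (u - x) := by
    refine le_fderiv_of_quadratic_minorant (c := 0) hφ.neg fun t ht0 ht1 => ?_
    have h := hconv.2 hx hu (sub_nonneg.2 ht1) ht0.le (by ring)
    have he : (1 - t) • x + t • u = x + t • (u - x) := by module
    rw [he] at h
    simp only [smul_eq_mul] at h
    simp only [Pi.neg_apply]
    linarith
  simp only [neg_apply] at key
  linarith

/-- The defining inequality of the weakly convex subdifferential, with the square completed. -/
theorem wsubdiff_le {X : Set E} {ρ : ℝ} {φ : E → ℝ} {x ξ u : E}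
    (hξ : ξ ∈ wsubdiff X ρ φ x) (hu : u ∈ X) :
    φ x + ⟪ξ, u - x⟫ - ρ / 2 * ‖u - x‖ ^ 2 ≤ φ u := by
  have h := hξ u hu
  have h1 : ‖u‖ ^ 2 = ‖x‖ ^ 2 + 2 * ⟪x, u - x⟫ + ‖u - x‖ ^ 2 := by
    rw [← norm_add_sq_real]; simp
  simp only [inner_add_left, real_inner_smul_left] at h
  rw [h1] at h
  linarith

variable [CompleteSpace E]

theorem wsubdiff_nonempty {X : Set E} {ρ : ℝ} {φ : E → ℝ} {x : E}
    (hconv : ConvexOn ℝ X fun u => φ u + ρ / 2 * ‖u‖ ^ 2) (hx : x ∈ X)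
    (hφ : DifferentiableAt ℝ φ x) : (wsubdiff X ρ φ x).Nonempty := by
  refine ⟨gradient φ x, fun u hu => ?_⟩
  have hd : HasFDerivAt (fun u => φ u + ρ / 2 * ‖u‖ ^ 2)
      (fderiv ℝ φ x + (ρ / 2) • ((2 : ℕ) • innerSL ℝ x)) x :=
    hφ.hasFDerivAt.add ((hasStrictFDerivAt_norm_sq x).hasFDerivAt.const_mul (ρ / 2))
  have h := hconv.add_fderiv_le hx hu hd
  have hgrad : ⟪gradient φ x, u - x⟫ = fderiv ℝ φ x (u - x) := by
    simp [gradient]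
  rw [inner_add_left, real_inner_smul_left, hgrad]
  simp only [add_apply, smul_apply, innerSL_apply_apply,
    smul_eq_mul, nsmul_eq_mul, Nat.cast_ofNat] at h
  linarith

/-- Against feasible directions a weak subgradient of a differentiable function is dominated by the
gradient. -/
theorem inner_le_inner_gradient_of_mem_wsubdiff {X : Set E} (hX : Convex ℝ X) {ρ : ℝ} {φ : E → ℝ}
    {x ξ u : E} (hξ : ξ ∈ wsubdiff X ρ φ x) (hx : x ∈ X) (hu : u ∈ X)
    (hφ : DifferentiableAt ℝ φ x) : ⟪ξ, u - x⟫ ≤ ⟪gradient φ x, u - x⟫ := by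
  have hgrad : ⟪gradient φ x, u - x⟫ = fderiv ℝ φ x (u - x) := by
    simp [gradient]
  rw [hgrad]
  refine le_fderiv_of_quadratic_minorant (c := ρ / 2 * ‖u - x‖ ^ 2) hφ.hasFDerivAt
    fun t ht0 ht1 => ?_
  have hmem : x + t • (u - x) ∈ X := hX.add_smul_sub_mem hx hu ⟨ht0.le, ht1⟩
  have h := wsubdiff_le hξ hmem
  rw [add_sub_cancel_left, real_inner_smul_right, norm_smul, Real.norm_of_nonneg ht0.le,
    mul_pow] at h
  linarith

theorem convexOn_inner_gradient_le {S : Set E} {φ : E → ℝ} {x u : E}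
    (hconv : ConvexOn ℝ S φ) (hx : x ∈ S) (hu : u ∈ S) (hφ : DifferentiableAt ℝ φ x) :
    φ x + ⟪gradient φ x, u - x⟫ ≤ φ u := by
  have hgrad : ⟪gradient φ x, u - x⟫ = fderiv ℝ φ x (u - x) := by
    simp [gradient]
  rw [hgrad]
  exact hconv.add_fderiv_le hx hu hφ.hasFDerivAt

end Subgradients

section MultiplierPair

variable {F : Type*} [NormedAddCommGroup F] {ι : Type*}

/-- The pair of multipliers as a vector of the Euclidean product space. -/
def multiplierPair (y : F) (z : ι → ℝ) : WithLp 2 (F × EuclideanSpace ℝ ι) :=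
  WithLp.toLp 2 (y, WithLp.toLp 2 z)

theorem multiplierPair_add_smul [NormedSpace ℝ F] (y r : F) (z s : ι → ℝ) (a : ℝ) :
    multiplierPair (y + a • r) (fun i => z i + a * s i)
      = multiplierPair y z + a • multiplierPair r s := by
  simp only [multiplierPair]
  rw [← WithLp.toLp_smul, ← WithLp.toLp_add]
  rfl

variable [Fintype ι]

theorem multiplierPair_norm_sq (y : F) (z : ι → ℝ) :
    ‖multiplierPair y z‖ ^ 2 = ‖y‖ ^ 2 + ∑ i, z i ^ 2 := by
  simp [multiplierPair, WithLp.prod_norm_sq_eq_of_L2, EuclideanSpace.norm_sq_eq]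

theorem multiplierPair_norm (y : F) (z : ι → ℝ) :
    ‖multiplierPair y z‖ = Real.sqrt (‖y‖ ^ 2 + ∑ i, z i ^ 2) := by
  rw [← multiplierPair_norm_sq, Real.sqrt_sq (norm_nonneg _)]

theorem multiplierPair_norm_le (y : F) (z : ι → ℝ) :
    ‖multiplierPair y z‖ ≤ ‖y‖ + ∑ i, |z i| := by
  have hs : 0 ≤ ∑ i, |z i| := Finset.sum_nonneg fun i _ => abs_nonneg _
  refine le_of_sq_le_sq ?_ (by positivity)
  rw [multiplierPair_norm_sq]
  have h := Finset.sum_sq_le_sq_sum_of_nonneg (s := Finset.univ) (f := fun i => |z i|)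
    fun i _ => abs_nonneg _
  simp only [sq_abs] at h
  nlinarith [norm_nonneg y]

end MultiplierPair

section AugmentedTerms

variable {E F : Type*} [NormedAddCommGroup E] [InnerProductSpace ℝ E]
  [NormedAddCommGroup F] [InnerProductSpace ℝ F] {ι : Type*} [Fintype ι]

/-- The penalty and multiplier terms of the augmented Lagrangian, as a function of the penalty
parameter `β`, the multipliers `y`, `z`, the equality residual `r` and the inequality values `c`. -/
def augTerm (β : ℝ) (y : F) (z : ι → ℝ) (r : F) (c : ι → ℝ) : ℝ :=
  ⟪y, r⟫ + β / 2 * ‖r‖ ^ 2 + β / 2 * ∑ i, max (c i + z i / β) 0 ^ 2 - (∑ i, z i ^ 2) / (2 * β)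

theorem multiplierPair_inner (y y' : F) (z z' : ι → ℝ) :
    ⟪multiplierPair y z, multiplierPair y' z'⟫ = ⟪y, y'⟫ + ∑ i, z i * z' i := by
  simp [multiplierPair, PiLp.inner_apply, mul_comm]

theorem max_add_div_sq_sub {β z c : ℝ} (hβ : 0 < β) :
    β / 2 * max (c + z / β) 0 ^ 2 - z ^ 2 / (2 * β)
      = z * max (-z / β) c + β / 2 * max (-z / β) c ^ 2 := by
  rcases le_total (-z / β) c with h | h
  · have h' : 0 ≤ c + z / β := by rw [neg_div] at h; linarith
    rw [max_eq_right h, max_eq_left h']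
    field_simp
    ring
  · have h' : c + z / β ≤ 0 := by rw [neg_div] at h; linarith
    rw [max_eq_left h, max_eq_right h']
    field_simp
    ring

theorem max_add_div_sq_sub_le {β z c s : ℝ} (hβ : 0 < β) (hs : c ≤ s) :
    β / 2 * max (c + z / β) 0 ^ 2 - z ^ 2 / (2 * β) ≤ z * s + β / 2 * s ^ 2 := by
  have h1 : max (c + z / β) 0 ^ 2 ≤ (s + z / β) ^ 2 := by
    rcases le_total (c + z / β) 0 with h | h
    · rw [max_eq_right h]; nlinarith [sq_nonneg (s + z / β)]
    · rw [max_eq_left h]; nlinarith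
  have h2 : β / 2 * (s + z / β) ^ 2 - z ^ 2 / (2 * β) = z * s + β / 2 * s ^ 2 := by
    field_simp
    ring
  nlinarith [mul_le_mul_of_nonneg_left h1 (half_pos hβ).le]

theorem augTerm_eq_sum (β : ℝ) (y r : F) (z c : ι → ℝ) :
    augTerm β y z r c = ⟪y, r⟫ + β / 2 * ‖r‖ ^ 2
      + ∑ i, (β / 2 * max (c i + z i / β) 0 ^ 2 - z i ^ 2 / (2 * β)) := by
  rw [augTerm, Finset.sum_sub_distrib, Finset.mul_sum, Finset.sum_div]
  ring

theorem augTerm_eq {β : ℝ} (hβ : 0 < β) (y r : F) (z c : ι → ℝ) :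
    augTerm β y z r c = ⟪multiplierPair y z, multiplierPair r fun i => max (-z i / β) (c i)⟫
      + β / 2 * ‖multiplierPair r fun i => max (-z i / β) (c i)‖ ^ 2 := by
  rw [augTerm_eq_sum, multiplierPair_inner, multiplierPair_norm_sq,
    Finset.sum_congr rfl fun i _ => max_add_div_sq_sub hβ, Finset.sum_add_distrib,
    ← Finset.mul_sum]
  ring

theorem augTerm_le {β : ℝ} (hβ : 0 < β) (y r : F) {z c s : ι → ℝ} (hs : ∀ i, c i ≤ s i) :
    augTerm β y z r c ≤ ⟪multiplierPair y z, multiplierPair r s⟫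
      + β / 2 * ‖multiplierPair r s‖ ^ 2 := by
  have h := Finset.sum_le_sum fun i (_ : i ∈ Finset.univ) =>
    max_add_div_sq_sub_le (z := z i) hβ (hs i)
  rw [Finset.sum_add_distrib, ← Finset.mul_sum] at h
  rw [augTerm_eq_sum, multiplierPair_inner, multiplierPair_norm_sq]
  linarith

theorem abs_augTerm_le {β B : ℝ} (hβ : 0 < β) {y r : F} {z c : ι → ℝ}
    (hp : ‖multiplierPair y z‖ ≤ B)
    (hq : ‖multiplierPair y z + β • multiplierPair r fun i => max (-z i / β) (c i)‖ ≤ B) :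
    |augTerm β y z r c| ≤ B ^ 2 / (2 * β) := by
  set q := multiplierPair r fun i => max (-z i / β) (c i) with hqdef
  set p := multiplierPair y z
  have h1 : augTerm β y z r c = (‖p + β • q‖ ^ 2 - ‖p‖ ^ 2) / (2 * β) := by
    rw [show augTerm β y z r c = ⟪p, q⟫ + β / 2 * ‖q‖ ^ 2 from augTerm_eq hβ y r z c,
      norm_add_sq_real, norm_smul, real_inner_smul_right,
      Real.norm_of_nonneg hβ.le]
    field_simp
    ring
  rw [h1, abs_div, abs_of_pos (show 0 < 2 * β by positivity)]
  refine div_le_div_of_nonneg_right ?_ (by positivity)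
  have h2 : ‖p‖ ^ 2 ≤ B ^ 2 := pow_le_pow_left₀ (norm_nonneg _) hp 2
  have h3 : ‖p + β • q‖ ^ 2 ≤ B ^ 2 := pow_le_pow_left₀ (norm_nonneg _) hq 2
  rw [abs_le]
  constructor <;> nlinarith [sq_nonneg ‖p‖, sq_nonneg ‖p + β • q‖]

/-- Effect of the multiplier and penalty updates on the augmented terms. -/
theorem augTerm_update_le {β β' α : ℝ} (hβ : 0 < β) (hβ' : 0 < β') (y r : F) (z c : ι → ℝ) :
    augTerm β' (y + α • r) (fun i => z i + α * max (-z i / β) (c i)) r c - augTerm β y z r c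
      ≤ (α + (β' - β) / 2) * ‖multiplierPair r fun i => max (-z i / β) (c i)‖ ^ 2 := by
  have h := augTerm_le hβ' (y + α • r) (z := fun i => z i + α * max (-z i / β) (c i)) r
    (s := fun i => max (-z i / β) (c i)) (c := c) fun i => le_max_right _ _
  rw [multiplierPair_add_smul, inner_add_left, real_inner_smul_left,
    real_inner_self_eq_norm_sq] at h
  rw [augTerm_eq hβ]
  linarith

theorem mul_max_sq_le {α β z c : ℝ} (hα : 0 ≤ α) (hβ : 0 < β) (hαβ : α ≤ β) (hz : 0 ≤ z) :
    α * max (-z / β) c ^ 2 ≤ α * max c 0 ^ 2 + (z ^ 2 - (z + α * max (-z / β) c) ^ 2) / β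
      + α / β * (max c 0 * (z + (z + α * max (-z / β) c))) := by
  have hzβ : -z / β ≤ 0 := by rw [neg_div]; exact neg_nonpos.2 (by positivity)
  rcases le_total 0 c with hc | hc
  · rw [max_eq_right (hzβ.trans hc), max_eq_left hc]
    refine le_of_eq ?_
    field_simp
    ring
  · rw [max_eq_right hc]
    set s := max (-z / β) c
    have hs0 : s ≤ 0 := max_le hzβ hc
    have hs1 : -z ≤ β * s := by
      have : -z / β ≤ s := le_max_left _ _
      rwa [div_le_iff₀' hβ] at this
    have hαs : -z ≤ α * s := hs1.trans (by nlinarith)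
    have : α * s ^ 2 ≤ (z ^ 2 - (z + α * s) ^ 2) / β := by
      rw [le_div_iff₀ hβ]
      nlinarith [mul_nonneg (mul_nonneg hα (neg_nonneg.2 hs0)) (by linarith : 0 ≤ z + α * s),
        mul_nonneg (mul_nonneg hα (neg_nonneg.2 hs0)) (by linarith : 0 ≤ z + β * s)]
    simpa using this

theorem damped_mul_norm_sq_le {α β B v : ℝ} {y r : F} {z c : ι → ℝ}
    (hα : 0 ≤ α) (hβ : 0 < β) (hαβ : α ≤ β) (hz : ∀ i, 0 ≤ z i) (hv : 0 ≤ v)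
    (hdamp : α * Real.sqrt (‖r‖ ^ 2 + ∑ i, max (c i) 0 ^ 2) ≤ v)
    (hp : ‖multiplierPair y z‖ ≤ B)
    (hp' : ‖multiplierPair (y + α • r) fun i => z i + α * max (-z i / β) (c i)‖ ≤ B)
    (hq : β * ‖multiplierPair r fun i => max (-z i / β) (c i)‖ ≤ 2 * B) :
    α * ‖multiplierPair r fun i => max (-z i / β) (c i)‖ ^ 2
      ≤ (∑ i, z i ^ 2 - ∑ i, (z i + α * max (-z i / β) (c i)) ^ 2) / β + 4 * B * (v / β) := by
  set s : ι → ℝ := fun i => max (-z i / β) (c i) with hs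
  set e : ℝ := Real.sqrt (‖r‖ ^ 2 + ∑ i, max (c i) 0 ^ 2) with he
  have hB : 0 ≤ B := (norm_nonneg _).trans hp
  have hpos : ∀ i, max (c i) 0 ^ 2 ≤ s i ^ 2 := by
    intro i
    rcases le_total 0 (c i) with h | h
    · rw [max_eq_left h]
      exact pow_le_pow_left₀ h (le_max_right _ _) 2
    · rw [max_eq_right h]
      nlinarith [sq_nonneg (s i)]
  have heq : e ≤ ‖multiplierPair r s‖ := by
    rw [multiplierPair_norm]
    exact Real.sqrt_le_sqrt (add_le_add le_rfl (Finset.sum_le_sum fun i _ => hpos i))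
  have he0 : 0 ≤ e := Real.sqrt_nonneg _
  have hesq : e ^ 2 = ‖r‖ ^ 2 + ∑ i, max (c i) 0 ^ 2 :=
    Real.sq_sqrt (add_nonneg (sq_nonneg _) (Finset.sum_nonneg fun i _ => sq_nonneg _))
  have hcross : ∑ i, max (c i) 0 * (z i + (z i + α * s i)) ≤ e * (2 * B) := by
    have h1 := real_inner_le_norm (multiplierPair r fun i => max (c i) 0)
      (multiplierPair (0 : F) z + multiplierPair (0 : F) fun i => z i + α * s i)
    have hz0 : ‖multiplierPair (0 : F) z‖ ≤ B := by
      refine le_trans ?_ hp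
      rw [multiplierPair_norm, multiplierPair_norm]
      exact Real.sqrt_le_sqrt (by simp)
    have hz1 : ‖multiplierPair (0 : F) fun i => z i + α * s i‖ ≤ B := by
      refine le_trans ?_ hp'
      rw [multiplierPair_norm, multiplierPair_norm]
      refine Real.sqrt_le_sqrt ?_
      rw [norm_zero]
      simp only [hs]
      nlinarith [sq_nonneg ‖y + α • r‖]
    have h2 : ‖multiplierPair r fun i => max (c i) 0‖ = e := multiplierPair_norm _ _
    rw [inner_add_right, multiplierPair_inner, multiplierPair_inner, inner_zero_right, zero_add,
      zero_add, h2] at h1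
    simp only [mul_add, Finset.sum_add_distrib] at h1 ⊢
    refine h1.trans (mul_le_mul_of_nonneg_left ?_ he0)
    exact (norm_add_le _ _).trans (by linarith)
  have hsum : α * ∑ i, s i ^ 2 ≤ α * ∑ i, max (c i) 0 ^ 2
      + (∑ i, z i ^ 2 - ∑ i, (z i + α * s i) ^ 2) / β
      + α / β * ∑ i, max (c i) 0 * (z i + (z i + α * s i)) := by
    rw [Finset.mul_sum, Finset.mul_sum, Finset.mul_sum, ← Finset.sum_sub_distrib, Finset.sum_div,
      ← Finset.sum_add_distrib, ← Finset.sum_add_distrib]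
    exact Finset.sum_le_sum fun i _ => mul_max_sq_le hα hβ hαβ (hz i)
  have h3 : α / β * ∑ i, max (c i) 0 * (z i + (z i + α * s i)) ≤ 2 * B * (v / β) := by
    calc _ ≤ α / β * (e * (2 * B)) := by gcongr
      _ = 2 * B * (α * e / β) := by ring
      _ ≤ 2 * B * (v / β) := by gcongr
  have h4 : α * e ^ 2 ≤ 2 * B * (v / β) := by
    have h5 : e ≤ 2 * B / β := by
      rw [le_div_iff₀' hβ]
      exact (mul_le_mul_of_nonneg_left heq hβ.le).trans hq
    calc α * e ^ 2 = (α * e) * e := by ring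
      _ ≤ v * (2 * B / β) := by gcongr
      _ = _ := by ring
  rw [multiplierPair_norm_sq]
  rw [hesq] at h4
  linarith

end AugmentedTerms

/-- In a compact set, the closed ball around an interior point whose radius is the distance to the
boundary stays inside the set, and this radius is positive. -/
theorem closedBall_infDist_frontier_subset {E : Type*} [NormedAddCommGroup E] [NormedSpace ℝ E]
    [Nontrivial E] [FiniteDimensional ℝ E] {X : Set E} (hX : IsCompact X) {x : E}
    (hx : x ∈ interior X) :
    0 < infDist x (frontier X) ∧ closedBall x (infDist x (frontier X)) ⊆ X := by
  have hxX : x ∈ X := interior_subset hx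
  obtain ⟨w, hw, hwd⟩ := hX.exists_mem_frontier_infDist_compl_eq_dist hxX
  constructor
  · refine (isClosed_frontier.notMem_iff_infDist_pos ⟨w, hw⟩).1 fun hfr => hfr.2 hx
  · have hle : infDist x (frontier X) ≤ infDist x Xᶜ := by
      rw [hwd]
      exact infDist_le_dist_of_mem hw
    refine (closedBall_subset_closedBall hle).trans ?_
    exact (closedBall_infDist_compl_subset_closure hxX).trans hX.isClosed.closure_subset

/-- The smallest positive eigenvalue of `A A†` is positive and controls `A†` on the range of `A`. -/
theorem sqrt_sInf_pos_eigenvalues_mul_norm_le {E F : Type*} [NormedAddCommGroup E]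
    [InnerProductSpace ℝ E] [CompleteSpace E] [NormedAddCommGroup F] [InnerProductSpace ℝ F]
    [FiniteDimensional ℝ F] [CompleteSpace F] {A : E →L[ℝ] F} (hA : A ≠ 0) {l : ℝ}
    (hl : l = sInf {μ : ℝ | 0 < μ ∧ ∃ w : F, w ≠ 0 ∧
      A (ContinuousLinearMap.adjoint A w) = μ • w}) :
    0 < l ∧ ∀ e : E, Real.sqrt l * ‖A e‖ ≤ ‖ContinuousLinearMap.adjoint A (A e)‖ := by
  set S := {μ : ℝ | 0 < μ ∧ ∃ w : F, w ≠ 0 ∧ A (ContinuousLinearMap.adjoint A w) = μ • w}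
  set T : F →ₗ[ℝ] F := (A.comp (ContinuousLinearMap.adjoint A)).toLinearMap with hT
  have hTapp : ∀ w, T w = A (ContinuousLinearMap.adjoint A w) := fun w => rfl
  have hTinner : ∀ w w', ⟪T w, w'⟫ =
      ⟪ContinuousLinearMap.adjoint A w, ContinuousLinearMap.adjoint A w'⟫ := fun w w' => by
    rw [hTapp, ContinuousLinearMap.adjoint_inner_right]
  have hsymm : T.IsSymmetric := fun w w' => by
    rw [hTinner, real_inner_comm, ← hTinner, real_inner_comm]
  let bas := hsymm.eigenvectorBasis rfl
  let μ := hsymm.eigenvalues rfl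
  have hbas : ∀ i, T (bas i) = μ i • bas i := fun i => hsymm.apply_eigenvectorBasis rfl i
  have hne : ∀ i, bas i ≠ 0 := fun i h => by
    have := bas.orthonormal.1 i
    rw [h, norm_zero] at this
    exact zero_ne_one this
  have hμ : ∀ i, μ i = ‖ContinuousLinearMap.adjoint A (bas i)‖ ^ 2 := fun i => by
    have h := hTinner (bas i) (bas i)
    rw [hbas, real_inner_smul_left, real_inner_self_eq_norm_sq, real_inner_self_eq_norm_sq,
      bas.orthonormal.1 i] at h
    simpa using h
  have hmem : ∀ i, μ i ≠ 0 → μ i ∈ S := fun i hi =>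
    ⟨lt_of_le_of_ne (by rw [hμ]; positivity) hi.symm, bas i, hne i, hbas i⟩
  have hfin : S.Finite := by
    refine (Module.End.finite_hasEigenvalue T).subset ?_
    rintro ν ⟨-, w, hw, hw'⟩
    exact Module.End.hasEigenvalue_of_hasEigenvector ⟨Module.End.mem_eigenspace_iff.2 hw', hw⟩
  have hnonempty : S.Nonempty := by
    by_contra hS
    have hzero : ∀ i, ContinuousLinearMap.adjoint A (bas i) = 0 := fun i => by
      have : μ i = 0 := by
        by_contra hi
        exact hS ⟨_, hmem i hi⟩
      rw [hμ] at this
      simpa using this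
    refine hA (ContinuousLinearMap.ext fun e => ?_)
    rw [← bas.sum_repr (A e)]
    refine Finset.sum_eq_zero fun i _ => ?_
    rw [bas.repr_apply_apply, ← ContinuousLinearMap.adjoint_inner_left, hzero, inner_zero_left,
      zero_smul]
  have hlmem : l ∈ S := hl ▸ hnonempty.csInf_mem hfin
  refine ⟨hlmem.1, fun e => le_of_sq_le_sq ?_ (norm_nonneg _)⟩
  rw [mul_pow, Real.sq_sqrt hlmem.1.le, ← real_inner_self_eq_norm_sq (ContinuousLinearMap.adjoint A
    (A e)), ← hTinner, ← bas.sum_inner_mul_inner, ← bas.sum_sq_norm_inner_right, Finset.mul_sum]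
  refine Finset.sum_le_sum fun i _ => ?_
  rw [hsymm, hbas, real_inner_smul_right, real_inner_comm (bas i), Real.norm_eq_abs, sq_abs]
  by_cases hi : μ i = 0
  · have h0 : ContinuousLinearMap.adjoint A (bas i) = 0 := by
      have h := hi
      rw [hμ] at h
      simpa using h
    have : ⟪bas i, A e⟫ = 0 := by
      rw [← ContinuousLinearMap.adjoint_inner_left, h0, inner_zero_left]
    rw [this]; simp
  · have hle : l ≤ μ i := hl ▸ csInf_le hfin.bddBelow (hmem i hi)
    nlinarith [sq_nonneg ⟪bas i, A e⟫]

/-- One step of the multiplier recursion keeps the multipliers in a ball. -/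
theorem norm_le_of_inner_sub_le {V : Type*} [NormedAddCommGroup V] [InnerProductSpace ℝ V]
    {p q : V} {κ B : ℝ} (hκ : 0 < κ) (hp : ‖p‖ ≤ B) (h : ⟪q, q - p⟫ ≤ κ * (B - ‖q‖)) :
    ‖q‖ ≤ B := by
  by_contra! hlt
  have h1 : ‖q‖ ^ 2 - ‖q‖ * ‖p‖ ≤ ⟪q, q - p⟫ := by
    rw [inner_sub_right, real_inner_self_eq_norm_sq]
    linarith [real_inner_le_norm q p]
  have h2 : κ * (B - ‖q‖) < 0 := mul_neg_of_pos_of_neg hκ (by linarith)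
  nlinarith [norm_nonneg q]

/-- A potential whose decrements dominate `1`, `1 / (2 log² 2)`, `1 / (3 log² 3)`, …. -/
theorem exists_logPotential : ∃ S : ℕ → ℝ, (∀ k, 0 ≤ S k) ∧ (∀ k, S k ≤ 4) ∧
    1 ≤ S 0 - S 1 ∧
    ∀ k : ℕ, 1 ≤ k → 1 / ((k + 1 : ℝ) * Real.log (k + 1) ^ 2) ≤ S k - S (k + 1) := by
  have hlog2 := Real.log_two_gt_d9
  have hl : (Real.log 2)⁻¹ ≤ 3 / 2 := by
    rw [inv_le_comm₀ (by linarith) (by norm_num)]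
    linarith
  have hpos : ∀ k : ℕ, 0 < Real.log ((k : ℝ) + 2) := fun k => Real.log_pos (by
    have : (0 : ℝ) ≤ k := k.cast_nonneg
    linarith)
  let S : ℕ → ℝ := fun k => match k with
    | 0 => 4
    | 1 => 3
    | (k + 2) => (Real.log ((k : ℝ) + 2))⁻¹
  have hS : ∀ k : ℕ, S (k + 2) ≤ 3 / 2 := fun k => by
    refine le_trans ?_ hl
    refine inv_anti₀ (by linarith) (Real.log_le_log (by norm_num) ?_)
    have : (0 : ℝ) ≤ k := k.cast_nonneg
    linarith
  refine ⟨S, ?_, ?_, ?_, ?_⟩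
  · rintro (_ | _ | k)
    · norm_num [S]
    · norm_num [S]
    · exact (inv_pos.2 (hpos k)).le
  · rintro (_ | _ | k)
    · norm_num [S]
    · norm_num [S]
    · linarith [hS k]
  · norm_num [S]
  · rintro (_ | _ | k) hk
    · omega
    · have h1 : S (0 + 1) - S (0 + 1 + 1) ≥ 3 / 2 := by
        have := hS 0
        simp only [S] at this ⊢
        linarith
      refine le_trans ?_ h1
      norm_num
      rw [inv_mul_le_iff₀ (by positivity)]
      nlinarith
    · have hk0 : (0 : ℝ) ≤ k := k.cast_nonneg
      have ha := hpos k
      have hb := hpos (k + 1)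
      simp only [S]
      push_cast at hb ⊢
      rw [show (k : ℝ) + 1 + 2 = k + 3 by ring] at hb ⊢
      rw [show (k : ℝ) + 1 + 1 + 1 = k + 3 by ring]
      set a := Real.log ((k : ℝ) + 2)
      set b := Real.log ((k : ℝ) + 3)
      have hab : 1 / ((k : ℝ) + 3) ≤ b - a := by
        have h := Real.one_sub_inv_le_log_of_pos (show 0 < ((k : ℝ) + 3) / (k + 2) by positivity)
        rw [Real.log_div (by positivity) (by positivity)] at h
        refine le_trans (le_of_eq ?_) h
        field_simp
        ring
      have hle : a ≤ b := Real.log_le_log (by positivity) (by linarith)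
      have h1 : a⁻¹ - b⁻¹ = (b - a) / (a * b) := by field_simp
      rw [h1, div_mul_eq_div_div]
      exact div_le_div₀ (by linarith [show 0 < 1 / ((k : ℝ) + 3) by positivity]) hab (by positivity)
        (by nlinarith)

/-- Telescoping with a bounded potential. -/
theorem sum_range_sub_le_of_potential {a c G : ℕ → ℝ} {M I Γ : ℝ}
    (hG0 : ∀ k, 0 ≤ G k) (hGΓ : ∀ k, G k ≤ Γ) (hc : ∀ k, |c k| ≤ M) (ha : a 0 ≤ M + I)
    (hI : 0 ≤ I) (hstep : ∀ k, a (k + 1) - c k ≤ G k - G (k + 1)) (K N : ℕ) :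
    ∑ j ∈ Finset.range (N + 1), (a (K + j) - c (K + j)) ≤ 2 * M + I + Γ := by
  have h1 : ∀ N, ∑ j ∈ Finset.range (N + 1), (a (K + j) - c (K + j))
      ≤ a K + G K - c (K + N) - G (K + N) := by
    intro N
    induction N with
    | zero =>
      simp only [zero_add, Finset.sum_range_one, add_zero]
      linarith
    | succ N ih =>
      rw [Finset.sum_range_succ]
      have := hstep (K + N)
      rw [← add_assoc]
      linarith
  have h2 : a K + G K ≤ M + I + Γ := by
    rcases K with _ | K
    · linarith [hGΓ 0]
    · linarith [hstep K, hGΓ K, (abs_le.1 (hc K)).2]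
  linarith [h1 N, hG0 (K + N), (abs_le.1 (hc (K + N))).1]

section Subproblem

variable {E F : Type*} [NormedAddCommGroup E] [InnerProductSpace ℝ E] [CompleteSpace E]
  [NormedAddCommGroup F] [InnerProductSpace ℝ F] [CompleteSpace F] {ι : Type*} [Fintype ι]

/-- The augmented terms lie above their linearization. -/
theorem augTerm_add_inner_le {β : ℝ} (hβ : 0 < β) (A : E →L[ℝ] F) (b : F) (y : F) (z : ι → ℝ)
    {g : ι → E → ℝ} {G : ι → E} {x u : E} (hg : ∀ i, g i x + ⟪G i, u - x⟫ ≤ g i u) :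
    augTerm β y z (A x - b) (fun i => g i x)
      + ⟪ContinuousLinearMap.adjoint A (y + β • (A x - b))
        + ∑ i, max (z i + β * g i x) 0 • G i, u - x⟫
      ≤ augTerm β y z (A u - b) fun i => g i u := by
  have hlin : ⟪ContinuousLinearMap.adjoint A (y + β • (A x - b)), u - x⟫
      = ⟪y, A u - b⟫ - ⟪y, A x - b⟫ + β * ⟪A x - b, A (u - x)⟫ := by
    rw [ContinuousLinearMap.adjoint_inner_left, inner_add_left, real_inner_smul_left,
      ← inner_sub_right]
    simp
  have hquad : ‖A u - b‖ ^ 2 = ‖A x - b‖ ^ 2 + 2 * ⟪A x - b, A (u - x)⟫ + ‖A (u - x)‖ ^ 2 := by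
    rw [← norm_add_sq_real]; simp
  have hcoord : ∀ i, β / 2 * max (g i x + z i / β) 0 ^ 2 - z i ^ 2 / (2 * β)
      + max (z i + β * g i x) 0 * ⟪G i, u - x⟫
      ≤ β / 2 * max (g i u + z i / β) 0 ^ 2 - z i ^ 2 / (2 * β) := by
    intro i
    have he : max (z i + β * g i x) 0 = β * max (g i x + z i / β) 0 := by
      rw [mul_max_of_nonneg _ _ hβ.le, mul_zero]
      congr 1
      field_simp
      ring
    rw [he]
    set m := max (g i x + z i / β) 0 with hm
    set m' := max (g i u + z i / β) 0
    have hm0 : 0 ≤ m := le_max_right _ _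
    have h1 : m * ⟪G i, u - x⟫ ≤ m * (g i u - g i x) :=
      mul_le_mul_of_nonneg_left (by linarith [hg i]) hm0
    have h2 : m * (g i x + z i / β) = m ^ 2 := by
      rw [hm]
      rcases le_total (g i x + z i / β) 0 with h | h
      · rw [max_eq_right h]; ring
      · rw [max_eq_left h]; ring
    have h3 : m * (g i u + z i / β) ≤ m * m' := mul_le_mul_of_nonneg_left (le_max_left _ _) hm0
    have h4 : m ^ 2 + 2 * (m * ⟪G i, u - x⟫) ≤ m' ^ 2 := by nlinarith [sq_nonneg (m - m')]
    nlinarith [mul_le_mul_of_nonneg_left h4 (half_pos hβ).le]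
  have hsum := Finset.sum_le_sum fun i (_ : i ∈ Finset.univ) => hcoord i
  rw [Finset.sum_add_distrib] at hsum
  have hG : ⟪∑ i, max (z i + β * g i x) 0 • G i, u - x⟫
      = ∑ i, max (z i + β * g i x) 0 * ⟪G i, u - x⟫ := by
    simp only [sum_inner, real_inner_smul_left]
  rw [augTerm_eq_sum, augTerm_eq_sum, inner_add_left, hlin, hG, hquad]
  nlinarith [mul_nonneg hβ.le (sq_nonneg ‖A (u - x)‖)]

/-- Sufficient decrease at an approximately stationary point of the proximal subproblem. -/
theorem augmented_descent {X : Set E} {f h : E → ℝ} {ρ β : ℝ} (hβ : 0 < β) (A : E →L[ℝ] F)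
    (b : F) (y : F) (z : ι → ℝ) {g : ι → E → ℝ} {G : ι → E} {x u w ξf ξh : E} (hu : u ∈ X)
    (hg : ∀ i, g i x + ⟪G i, u - x⟫ ≤ g i u) (hξf : ξf ∈ wsubdiff X ρ f x)
    (hξh : ξh ∈ csubdiff X h x)
    (hw : w = ξf + ξh + ContinuousLinearMap.adjoint A (y + β • (A x - b))
      + (∑ i, max (z i + β * g i x) 0 • G i) + (2 * ρ) • (x - u)) :
    3 * ρ / 2 * ‖x - u‖ ^ 2 - ‖w‖ * ‖x - u‖
      ≤ (f u + h u + augTerm β y z (A u - b) fun i => g i u)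
        - (f x + h x + augTerm β y z (A x - b) fun i => g i x) := by
  have h1 := wsubdiff_le hξf hu
  have h2 := hξh u hu
  have h3 := augTerm_add_inner_le hβ A b y z hg
  have h4 : ⟪w, u - x⟫ = ⟪ξf, u - x⟫ + ⟪ξh, u - x⟫
      + ⟪ContinuousLinearMap.adjoint A (y + β • (A x - b))
        + ∑ i, max (z i + β * g i x) 0 • G i, u - x⟫ - 2 * ρ * ‖x - u‖ ^ 2 := by
    rw [hw]
    simp only [inner_add_left, real_inner_smul_left]
    rw [← neg_sub x u, inner_neg_right (x - u), real_inner_self_eq_norm_sq]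
    ring
  have h5 : -(‖w‖ * ‖x - u‖) ≤ ⟪w, u - x⟫ := by
    rw [norm_sub_rev x u]
    exact neg_le_of_abs_le (abs_real_inner_le_norm w (u - x))
  rw [norm_sub_rev u x] at h1
  linarith

/-- Testing the approximate stationarity condition against a point of the domain. -/
theorem stationarity_test {X : Set E} (hX : Convex ℝ X) {f : E → ℝ} {ρ rh Bf D ω : ℝ}
    (hρ : 0 < ρ) (A : E →L[ℝ] F) {g : ι → E → ℝ} {G : ι → E} {x u x' w ξf ξh : E}
    {yh : F} {zh : ι → ℝ} (hzh : ∀ i, 0 ≤ zh i) (hx : x ∈ X) (hu : u ∈ X) (hx' : x' ∈ X)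
    (hD : ∀ p ∈ X, ∀ q ∈ X, ‖p - q‖ ≤ D) (hfd : DifferentiableAt ℝ f x)
    (hfB : ‖gradient f x‖ ≤ Bf)
    (hh : ∃ w v, ξh = w + v ∧ (∀ u ∈ X, ⟪w, u - x⟫ ≤ 0) ∧ ‖v‖ ≤ rh)
    (hg : ∀ i, g i x + ⟪G i, u - x⟫ ≤ g i u) (hξf : ξf ∈ wsubdiff X ρ f x)
    (hw : w = ξf + ξh + ContinuousLinearMap.adjoint A yh + (∑ i, zh i • G i) + (2 * ρ) • (x - x'))
    (hω : ‖w‖ ≤ ω) :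
    ⟪yh, A (x - u)⟫ + ∑ i, zh i * (g i x - g i u) ≤ ω * D + D * (Bf + 2 * ρ * D + rh) := by
  obtain ⟨nv, v, rfl, hnv, hv⟩ := hh
  have hux : ‖u - x‖ ≤ D := hD u hu x hx
  have hxx' : ‖x - x'‖ ≤ D := hD x hx x' hx'
  have hD0 : 0 ≤ D := (norm_nonneg _).trans hux
  have h1 : ⟪ξf, u - x⟫ ≤ Bf * D := by
    refine (inner_le_inner_gradient_of_mem_wsubdiff hX hξf hx hu hfd).trans ?_
    refine (real_inner_le_norm _ _).trans ?_
    exact mul_le_mul hfB hux (norm_nonneg _) ((norm_nonneg _).trans hfB)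
  have h2 : ⟪v, u - x⟫ ≤ rh * D := (real_inner_le_norm _ _).trans
    (mul_le_mul hv hux (norm_nonneg _) ((norm_nonneg _).trans hv))
  have h3 : ⟪x - x', u - x⟫ ≤ D * D := (real_inner_le_norm _ _).trans
    (mul_le_mul hxx' hux (norm_nonneg _) hD0)
  have h4 : -(ω * D) ≤ ⟪w, u - x⟫ := by
    refine neg_le_of_abs_le ((abs_real_inner_le_norm _ _).trans ?_)
    exact mul_le_mul hω hux (norm_nonneg _) ((norm_nonneg _).trans hω)
  have h5 : ⟪w, u - x⟫ = ⟪ξf, u - x⟫ + (⟪nv, u - x⟫ + ⟪v, u - x⟫) - ⟪yh, A (x - u)⟫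
      + ∑ i, zh i * ⟪G i, u - x⟫ + 2 * ρ * ⟪x - x', u - x⟫ := by
    rw [hw]
    simp only [inner_add_left, real_inner_smul_left, ContinuousLinearMap.adjoint_inner_left,
      sum_inner]
    rw [← neg_sub x u, map_neg, inner_neg_right yh]
    ring
  have h6 : ∑ i, zh i * (g i x - g i u) ≤ -∑ i, zh i * ⟪G i, u - x⟫ := by
    rw [← Finset.sum_neg_distrib]
    refine Finset.sum_le_sum fun i _ => ?_
    nlinarith [mul_le_mul_of_nonneg_left (hg i) (hzh i)]
  have h7 := hnv u hu
  nlinarith [mul_le_mul_of_nonneg_left h3 hρ.le]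

theorem add_mul_max_neg_div {β z c : ℝ} (hβ : 0 < β) :
    z + β * max (-z / β) c = max (z + β * c) 0 := by
  rw [mul_max_of_nonneg _ _ hβ.le, ← max_add_add_left, mul_div_cancel₀ _ hβ.ne', add_neg_cancel,
    max_comm]

/-- The undamped multiplier update stays in a ball, by Slater's condition. -/
theorem multiplier_update_norm_le {X : Set E} {A : E →L[ℝ] F} {b y : F} {z : ι → ℝ}
    {g : ι → E → ℝ} {x xs : E} {β τ γ κ B R : ℝ} (hβ : 0 < β) (hτ : 0 ≤ τ) (hκ : 0 < κ)
    (hκγ : κ ≤ γ) (hxs : A xs = b)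
    (hball : ∀ u, ‖u - xs‖ ≤ τ → u ∈ X ∧ ∀ i, g i u ≤ -γ)
    (hκy : κ * ‖y + β • (A x - b)‖ ≤ τ * ‖ContinuousLinearMap.adjoint A (y + β • (A x - b))‖)
    (htest : ∀ u ∈ X, ⟪y + β • (A x - b), A (x - u)⟫
      + ∑ i, max (z i + β * g i x) 0 * (g i x - g i u) ≤ R)
    (hR : R ≤ κ * B) (hp : ‖multiplierPair y z‖ ≤ B) :
    ‖multiplierPair y z + β • multiplierPair (A x - b) fun i => max (-z i / β) (g i x)‖ ≤ B := by
  set yh := y + β • (A x - b) with hyh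
  set zh : ι → ℝ := fun i => max (z i + β * g i x) 0 with hzh
  set a := ContinuousLinearMap.adjoint A yh with ha
  have hzh0 : ∀ i, 0 ≤ zh i := fun i => le_max_right _ _
  have hph : multiplierPair y z + β • multiplierPair (A x - b) (fun i => max (-z i / β) (g i x))
      = multiplierPair yh zh := by
    rw [← multiplierPair_add_smul]
    simp only [add_mul_max_neg_div hβ]
    rfl
  refine norm_le_of_inner_sub_le (κ := β * κ) (mul_pos hβ hκ) hp ?_
  rw [add_sub_cancel_left, hph, real_inner_smul_right, multiplierPair_inner, mul_assoc]
  refine mul_le_mul_of_nonneg_left ?_ hβ.le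
  set u := xs - (τ / ‖a‖) • a with hu
  have hunorm : ‖u - xs‖ ≤ τ := by
    rw [hu, sub_sub_cancel_left, norm_neg, norm_smul, Real.norm_of_nonneg (by positivity)]
    rcases eq_or_ne ‖a‖ 0 with h0 | h0
    · rw [h0]; simpa using hτ
    · rw [div_mul_cancel₀ _ h0]
  obtain ⟨huX, hgu⟩ := hball u hunorm
  have h1 := htest u huX
  have h2 : ⟪yh, A (x - u)⟫ = ⟪yh, A x - b⟫ + τ * ‖a‖ := by
    have : x - u = (x - xs) + (τ / ‖a‖) • a := by rw [hu]; abel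
    rw [this, map_add, map_sub, hxs, map_smul, inner_add_right, real_inner_smul_right,
      ← ContinuousLinearMap.adjoint_inner_left, ← ha, real_inner_self_eq_norm_sq]
    rcases eq_or_ne ‖a‖ 0 with h0 | h0
    · rw [h0]; simp
    · field_simp
  have h3 : ∑ i, zh i * max (-z i / β) (g i x) + κ * ∑ i, |zh i|
      ≤ ∑ i, zh i * (g i x - g i u) := by
    rw [Finset.mul_sum, ← Finset.sum_add_distrib]
    refine Finset.sum_le_sum fun i _ => ?_
    have h4 : zh i * max (-z i / β) (g i x) = zh i * g i x := by
      rcases le_total (-z i / β) (g i x) with h | h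
      · rw [max_eq_right h]
      · have : zh i = 0 := by
          exact max_eq_right (by
            have := (le_div_iff₀' hβ).1 h
            linarith)
        rw [this]; ring
    rw [h4, abs_of_nonneg (hzh0 i)]
    nlinarith [mul_le_mul_of_nonneg_left (hgu i) (hzh0 i),
      mul_le_mul_of_nonneg_right hκγ (hzh0 i)]
  have h5 := mul_le_mul_of_nonneg_left (multiplierPair_norm_le yh zh) hκ.le
  linarith

end Subproblem

/-- Decrements of the reciprocals of `β₀ √(k + 1)`. -/
theorem sqrt_growth {β₀ : ℝ} (hβ₀ : 0 < β₀) (k : ℕ) :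
    (β₀ * Real.sqrt ((k + 1 : ℕ) + 1) - β₀ * Real.sqrt (k + 1)) / 2
        * (4 / (β₀ * Real.sqrt (k + 1)) ^ 2)
      ≤ 3 * (1 / (β₀ * Real.sqrt (k + 1)) - 1 / (β₀ * Real.sqrt ((k + 1 : ℕ) + 1))) := by
  push_cast
  have hk : (0 : ℝ) ≤ k := k.cast_nonneg
  set s := Real.sqrt ((k : ℝ) + 1) with hs
  set t := Real.sqrt ((k : ℝ) + 1 + 1) with ht
  have hs0 : 0 < s := Real.sqrt_pos.2 (by linarith)
  have ht0 : 0 < t := Real.sqrt_pos.2 (by linarith)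
  have hst : s ≤ t := Real.sqrt_le_sqrt (by linarith)
  have hts : 2 * t ≤ 3 * s := by
    refine le_of_sq_le_sq ?_ (by positivity)
    rw [mul_pow, mul_pow, hs, ht, Real.sq_sqrt (by linarith), Real.sq_sqrt (by linarith)]
    linarith
  have h1 : 3 * (1 / (β₀ * s) - 1 / (β₀ * t)) = (t - s) * (3 * s) / (β₀ * s ^ 2 * t) := by
    field_simp
  have h2 : (β₀ * t - β₀ * s) / 2 * (4 / (β₀ * s) ^ 2) = (t - s) * (2 * t) / (β₀ * s ^ 2 * t) := by
    field_simp
    ring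
  rw [h1, h2]
  gcongr

/-- A minimizing-distance bound gives an element of norm below any larger threshold. -/
theorem exists_mem_norm_lt_of_infDist_le {E : Type*} [NormedAddCommGroup E] {S : Set E}
    (hS : S.Nonempty) {δ ω : ℝ} (h : infDist 0 S ≤ δ) (hω : δ < ω) : ∃ w ∈ S, ‖w‖ < ω := by
  obtain ⟨w, hw, hlt⟩ := (infDist_lt_iff hS).1 (h.trans_lt hω)
  exact ⟨w, hw, by simpa using hlt⟩

set_option maxHeartbeats 4000000 in
/-- **Lemma 8, near stationarity in the smooth case.**
Given `ε > 0`, under Assumptions (A1)–(A5), let `{x^k, y^k, z^k}` be generated by DPALM with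
the parameter choice `β_k = β₀√(k+1)`, `v_k = v₀/(√(k+1)(log(k+1))²)`, where each `x^{k+1}`
satisfies `dist(0, ∂_x L̃_{β_k}(x^{k+1}; y^k, z^k)) ≤ ε_k := min{ε/8, √(ρ/(2β_k)), 1}`. Then
for `K₂ := ⌈5 C_x ρ ε⁻²⌉` and any integer `K̃₁ ≥ 0`,
`min_{K̃₁ ≤ k ≤ K̃₁+K₂−1} dist(0, ∂_x L_{β_k}(x^{k+1}; y^k, z^k)) ≤ ε`. -/
theorem dpalm_smooth_near_stationarity
    (d n m : ℕ) (hm : 0 < m)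
    (A : EuclideanSpace ℝ (Fin d) →L[ℝ] EuclideanSpace ℝ (Fin n))
    (b : EuclideanSpace ℝ (Fin n))
    (f h : EuclideanSpace ℝ (Fin d) → ℝ)
    (g : Fin m → EuclideanSpace ℝ (Fin d) → ℝ)
    (X : Set (EuclideanSpace ℝ (Fin d)))
    -- (A1): X = dom F is compact with diameter D, f is ρ-weakly convex on X, h closed convex
    (hXcomp : IsCompact X) (hXne : X.Nonempty)
    (D : ℝ) (hD : IsGreatest {t | ∃ x₁ ∈ X, ∃ x₂ ∈ X, t = ‖x₁ - x₂‖} D)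
    (ρ : ℝ) (hρ : 0 < ρ)
    (hfwc : ConvexOn ℝ X (fun u => f u + ρ / 2 * ‖u‖ ^ 2))
    (hhconv : ConvexOn ℝ X h) (hhlsc : LowerSemicontinuous h)
    -- (A2): each gᵢ is convex, L_g-smooth on an open set U ⊇ X, with the bounds (B_g)
    (Lg Bg : ℝ) (hBg : 0 < Bg)
    (U : Set (EuclideanSpace ℝ (Fin d))) (hUopen : IsOpen U) (hXU : X ⊆ U)
    (hgconv : ∀ i, ConvexOn ℝ Set.univ (g i))
    (hgdiff : ∀ i, DifferentiableOn ℝ (g i) U)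
    (hgsmooth : ∀ i, ∀ u ∈ U, ∀ u' ∈ U, ‖gradient (g i) u - gradient (g i) u'‖ ≤ Lg * ‖u - u'‖)
    (hgbound : ∀ i, ∀ u ∈ X, |g i u| ≤ Bg ∧ ‖gradient (g i) u‖ ≤ Bg)
    (hglip : ∀ i, ∀ u ∈ X, ∀ u' ∈ X, |g i u - g i u'| ≤ Bg * ‖u - u'‖)
    -- (A3): strictly feasible interior point
    (xfeas : EuclideanSpace ℝ (Fin d)) (hxfeas : xfeas ∈ interior X)
    (hAxfeas : A xfeas = b)
    (gmin : ℝ) (hgminpos : 0 < gmin)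
    (hgmin : IsLeast {t | ∃ i, t = -(g i xfeas)} gmin)
    -- (A4): ∂h(x) ⊆ N_X(x) + B_{r_h} and ∂h(x) ≠ ∅ on X
    (rh : ℝ) (hrh : 0 < rh)
    (hhsubne : ∀ u ∈ X, (csubdiff X h u).Nonempty)
    (hhsub : ∀ u ∈ X, ∀ ξ ∈ csubdiff X h u,
      ∃ w v, ξ = w + v ∧ (∀ u' ∈ X, ⟪w, u' - u⟫ ≤ 0) ∧ ‖v‖ ≤ rh)
    -- DPALM iterates and dual updates
    (β v : ℕ → ℝ) (hβpos : ∀ k, 0 < β k) (hβmono : Monotone β) (hvpos : ∀ k, 0 < v k)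
    (x : ℕ → EuclideanSpace ℝ (Fin d))
    (y : ℕ → EuclideanSpace ℝ (Fin n)) (z : ℕ → Fin m → ℝ)
    (hx0 : x 0 ∈ X) (hy0 : ∃ w, A w = y 0) (hz0 : ∀ i, 0 ≤ z 0 i)
    (α pfeas : ℕ → ℝ)
    (hpfeas : ∀ k, pfeas k =
      Real.sqrt (‖A (x (k + 1)) - b‖ ^ 2 + ∑ i, max (g i (x (k + 1))) 0 ^ 2))
    (hα : ∀ k, α k = if pfeas k = 0 then β k else min (β k) (v k / pfeas k))
    (hyupd : ∀ k, y (k + 1) = y k + α k • (A (x (k + 1)) - b))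
    (hzupd : ∀ k, ∀ i, z (k + 1) i = z k i + α k * max (-(z k i) / β k) (g i (x (k + 1))))
    -- (A5): f is L_f-smooth on an open set containing X, with ‖∇f‖ ≤ B_f on X
    (Lf Bf : ℝ) (hBf : 0 < Bf)
    (U' : Set (EuclideanSpace ℝ (Fin d))) (hU'open : IsOpen U') (hXU' : X ⊆ U')
    (hfdiff : DifferentiableOn ℝ f U')
    (hfsmooth : ∀ u ∈ U', ∀ u' ∈ U', ‖gradient f u - gradient f u'‖ ≤ Lf * ‖u - u'‖)
    (hfgradbd : ∀ u ∈ X, ‖gradient f u‖ ≤ Bf)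
    -- the parameter choice β_k = β₀√(k+1), v_k = v₀/(√(k+1)(log(k+1))²) (k ≥ 1)
    (β₀ v₀ : ℝ) (hβ₀ : 0 < β₀) (hv₀ : 0 < v₀)
    (hβch : ∀ k : ℕ, β k = β₀ * Real.sqrt (k + 1))
    (hvch0 : v 0 = v₀)
    (hvch : ∀ k : ℕ, 1 ≤ k → v k = v₀ / (Real.sqrt (k + 1) * Real.log (k + 1) ^ 2))
    -- the accuracy requirement: x^{k+1} ∈ X is an ε_k-stationary point of the
    -- strongly convex subproblem  min_x L̃_{β_k}(x; y^k, z^k)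
    (ε : ℝ) (hεpos : 0 < ε)
    (εseq : ℕ → ℝ)
    (hεseq : ∀ k, εseq k = min (ε / 8) (min (Real.sqrt (ρ / (2 * β k))) 1))
    (happrox : ∀ k, x (k + 1) ∈ X ∧
      Metric.infDist (0 : EuclideanSpace ℝ (Fin d))
        {w | ∃ ξf ∈ wsubdiff X ρ f (x (k + 1)), ∃ ξh ∈ csubdiff X h (x (k + 1)),
          w = ξf + ξh
            + ContinuousLinearMap.adjoint A (y k + β k • (A (x (k + 1)) - b))
            + (∑ i, max (z k i + β k * g i (x (k + 1))) 0 • gradient (g i) (x (k + 1)))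
            + (2 * ρ) • (x (k + 1) - x k)} ≤ εseq k)
    -- the constants τ, B̄, λ⁺_min(AAᵀ), θ, B₀, B_p = B₀, Q, C₁, Ĉ_p, C_p = 2Ĉ_p, Fmax, C_x
    (τ Bbar lamm θ B0 Bp Q C₁ Chp Cp Fmax Cx : ℝ)
    (hτ : τ = min (gmin / (2 * Real.sqrt m * Bg)) (Metric.infDist xfeas (frontier X)))
    (hBbar : Bbar = D * (rh + Bf) + 2 * ρ * D ^ 2 + D + τ * (1 + rh + Bf + 2 * ρ * D))
    (hlamm : lamm = sInf {μ : ℝ | 0 < μ ∧ ∃ w : EuclideanSpace ℝ (Fin n), w ≠ 0 ∧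
        A (ContinuousLinearMap.adjoint A w) = μ • w})
    (hθ : θ = Bbar / min (τ * Real.sqrt lamm) (gmin / 2))
    (hB0 : B0 = max (Real.sqrt (‖y 0‖ ^ 2 + ∑ i, z 0 i ^ 2)) θ)
    (hBp : Bp = B0)
    (hQ : Q = D * (Bf + 2 * ρ * D + rh))
    (hC₁ : C₁ = 1 / D + 1 / Metric.infDist xfeas (frontier X) + Bg / gmin)
    (hChp : Chp = 2 * (Bp + Real.sqrt (Q ^ 2 / gmin ^ 2
        + Q ^ 2 * ‖(mpPinv (A.comp (ContinuousLinearMap.adjoint A))).comp A‖ ^ 2 * C₁ ^ 2)) + 1)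
    (hCp : Cp = 2 * Chp)
    (hFmax : IsGreatest ((fun u => |f u + h u|) '' X) Fmax)
    (hCx : Cx = 2 * Fmax + 1 / (4 * β₀) * (14 * Cp ^ 2 + 8 * Bp * Cp + 7 * Bp ^ 2)
        + (10 * Cp + 4 * Bp) * (v₀ / β₀)
        + β₀ / 2 * (‖A (x 0) - b‖ ^ 2 + ∑ i, max (g i (x 0) + z 0 i / β₀) 0 ^ 2)
        + |⟪y 0, A (x 0) - b⟫|)
    (K₂ : ℕ) (hK₂ : K₂ = ⌈5 * Cx * ρ / ε ^ 2⌉₊)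
    :
    ∀ Kt1 : ℕ, ∃ k : ℕ, Kt1 ≤ k ∧ k < Kt1 + K₂ ∧
      Metric.infDist (0 : EuclideanSpace ℝ (Fin d))
        {w | ∃ ξf ∈ wsubdiff X ρ f (x (k + 1)), ∃ ξh ∈ csubdiff X h (x (k + 1)),
          w = ξf + ξh
            + ContinuousLinearMap.adjoint A (y k + β k • (A (x (k + 1)) - b))
            + (∑ i, max (z k i + β k * g i (x (k + 1))) 0 • gradient (g i) (x (k + 1)))} ≤ ε := by
  intro Kt1
  have hXconv : Convex ℝ X := hhconv.1
  have hxX : ∀ k, x k ∈ X := fun k => by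
    rcases k with _ | k
    · exact hx0
    · exact (happrox k).1
  have hDle : ∀ p ∈ X, ∀ q ∈ X, ‖p - q‖ ≤ D := fun p hp q hq => hD.2 ⟨p, hp, q, hq, rfl⟩
  have hD0 : 0 ≤ D := (norm_nonneg _).trans (hDle _ hx0 _ hx0)
  have hfdiffX : ∀ u ∈ X, DifferentiableAt ℝ f u := fun u hu =>
    (hfdiff u (hXU' hu)).differentiableAt (hU'open.mem_nhds (hXU' hu))
  have hgdiffX : ∀ i, ∀ u ∈ X, DifferentiableAt ℝ (g i) u := fun i u hu =>
    (hgdiff i u (hXU hu)).differentiableAt (hUopen.mem_nhds (hXU hu))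
  have hglin : ∀ u ∈ X, ∀ p ∈ X, ∀ i, g i u + ⟪gradient (g i) u, p - u⟫ ≤ g i p :=
    fun u hu p _ i =>
      convexOn_inner_gradient_le (hgconv i) (Set.mem_univ _) (Set.mem_univ _) (hgdiffX i u hu)
  -- signs of the constants
  have hBp0 : 0 ≤ Bp := by
    rw [hBp, hB0]; exact (Real.sqrt_nonneg _).trans (le_max_left _ _)
  have hQ0 : 0 ≤ Q := by rw [hQ]; positivity
  have hQρ : 2 * ρ * D ^ 2 ≤ Q := by
    rw [hQ]; nlinarith only [mul_nonneg hD0 (add_pos hBf hrh).le]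
  have hCpBp : 4 * Bp + 4 * (Q / gmin) + 2 ≤ Cp := by
    have h1 : Q / gmin ≤ Real.sqrt (Q ^ 2 / gmin ^ 2 + Q ^ 2
        * ‖(mpPinv (A.comp (ContinuousLinearMap.adjoint A))).comp A‖ ^ 2 * C₁ ^ 2) := by
      refine Real.le_sqrt_of_sq_le ?_
      rw [div_pow]
      have : 0 ≤ Q ^ 2 * ‖(mpPinv (A.comp (ContinuousLinearMap.adjoint A))).comp A‖ ^ 2
        * C₁ ^ 2 := by positivity
      linarith only [this]
    rw [hCp, hChp]
    linarith only [h1]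
  have hQg : 0 ≤ Q / gmin := by positivity
  have hFmax0 : 0 ≤ Fmax := (abs_nonneg _).trans (hFmax.2 ⟨x 0, hx0, rfl⟩)
  set I : ℝ := β₀ / 2 * (‖A (x 0) - b‖ ^ 2 + ∑ i, max (g i (x 0) + z 0 i / β₀) 0 ^ 2)
    + |⟪y 0, A (x 0) - b⟫| with hI
  have hI0 : 0 ≤ I := by
    have : 0 ≤ ∑ i, max (g i (x 0) + z 0 i / β₀) 0 ^ 2 :=
      Finset.sum_nonneg fun i _ => sq_nonneg _
    positivity
  have hv₀β₀ : 0 < v₀ / β₀ := by positivity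
  have hCxlow : 2 * Fmax + 7 / 2 * (Cp ^ 2 / β₀) + 10 * Cp * (v₀ / β₀) + I ≤ Cx := by
    have h1 : 1 / (4 * β₀) * (14 * Cp ^ 2 + 8 * Bp * Cp + 7 * Bp ^ 2)
        = 7 / 2 * (Cp ^ 2 / β₀) + 2 * (Bp * Cp / β₀) + 7 / 4 * (Bp ^ 2 / β₀) := by
      field_simp
      ring
    have h2 : 0 ≤ Bp * Cp / β₀ := by
      have : 0 ≤ Cp := by linarith only [hCpBp, hBp0, hQg]
      positivity
    have h3 : 0 ≤ Bp ^ 2 / β₀ := by positivity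
    rw [hCx, h1, hI]
    linarith only [mul_nonneg hBp0 hv₀β₀.le, h2, h3]
  have hCx0 : 0 < Cx := by
    have hCp0 : 0 < Cp := by linarith only [hCpBp, hBp0, hQg]
    have hCp2 : 0 < Cp ^ 2 / β₀ := by positivity
    have hCpv : 0 < Cp * (v₀ / β₀) := by positivity
    linarith only [hCxlow, hFmax0, hI0, hCp2, hCpv]
  have hK₂pos : 0 < K₂ := by
    rw [hK₂]; exact Nat.ceil_pos.2 (by positivity)
  -- approximate stationarity certificates
  have hcert : ∀ k, ∃ w ξf ξh, ξf ∈ wsubdiff X ρ f (x (k + 1)) ∧ ξh ∈ csubdiff X h (x (k + 1)) ∧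
      w = ξf + ξh + ContinuousLinearMap.adjoint A (y k + β k • (A (x (k + 1)) - b))
        + (∑ i, max (z k i + β k * g i (x (k + 1))) 0 • gradient (g i) (x (k + 1)))
        + (2 * ρ) • (x (k + 1) - x k) ∧ ‖w‖ ≤ ε / 7 ∧ ‖w‖ ≤ 8 / 7 := by
    intro k
    obtain ⟨ξf, hξf⟩ := wsubdiff_nonempty hfwc (hxX (k + 1)) (hfdiffX _ (hxX (k + 1)))
    obtain ⟨ξh, hξh⟩ := hhsubne _ (hxX (k + 1))
    have hlt : εseq k < min (ε / 7) (8 / 7) := by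
      rw [hεseq, lt_min_iff]
      constructor
      · exact (min_le_left _ _).trans_lt (by linarith only [hεpos])
      · exact ((min_le_right _ _).trans (min_le_right _ _)).trans_lt (by norm_num)
    have hmem := fun hne => exists_mem_norm_lt_of_infDist_le hne (happrox k).2 hlt
    obtain ⟨w, ⟨ξf', hξf', ξh', hξh', hw⟩, hwlt⟩ := hmem ⟨_, ξf, hξf, ξh, hξh, rfl⟩
    exact ⟨w, ξf', ξh', hξf', hξh', hw, (hwlt.trans_le (min_le_left _ _)).le,
      (hwlt.trans_le (min_le_right _ _)).le⟩
  choose w ξf ξh hξf hξh hw hwε hw1 using hcert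
  by_contra! hcon
  -- every step in the window is long
  have hlong : ∀ k, Kt1 ≤ k → k < Kt1 + K₂ → 3 * ε / 7 < ρ * ‖x (k + 1) - x k‖ := by
    intro k hk1 hk2
    have h1 := hcon k hk1 hk2
    have h2 := infDist_le_dist_of_mem (x := (0 : EuclideanSpace ℝ (Fin d)))
      (show w k - (2 * ρ) • (x (k + 1) - x k) ∈ {w | ∃ ξf ∈ wsubdiff X ρ f (x (k + 1)),
        ∃ ξh ∈ csubdiff X h (x (k + 1)),
          w = ξf + ξh
            + ContinuousLinearMap.adjoint A (y k + β k • (A (x (k + 1)) - b))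
            + (∑ i, max (z k i + β k * g i (x (k + 1))) 0 • gradient (g i) (x (k + 1)))} from
        ⟨ξf k, hξf k, ξh k, hξh k, by rw [hw k, add_sub_cancel_right]⟩)
    rw [dist_zero_left] at h2
    have h3 := norm_sub_le (w k) ((2 * ρ) • (x (k + 1) - x k))
    rw [norm_smul, Real.norm_of_nonneg (by positivity)] at h3
    linarith only [hwε k, h1, h2, h3]
  have hερ : 3 * ε / 7 < ρ * D := by
    refine (hlong Kt1 le_rfl (by omega)).trans_le ?_
    exact mul_le_mul_of_nonneg_left (hDle _ (hxX _) _ (hxX _)) hρ.le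
  have hDpos : 0 < D := by
    by_contra! h
    linarith only [hερ, hεpos, mul_nonneg hρ.le (sub_nonneg.2 h)]
  -- the multiplier updates
  have hpf0 : ∀ k, 0 ≤ pfeas k := fun k => by rw [hpfeas]; exact Real.sqrt_nonneg _
  have hα0 : ∀ k, 0 ≤ α k := fun k => by
    rw [hα]
    split_ifs
    · exact (hβpos k).le
    · exact le_min (hβpos k).le (div_nonneg (hvpos k).le (hpf0 k))
  have hαβ : ∀ k, α k ≤ β k := fun k => by
    rw [hα]
    split_ifs
    · exact le_rfl
    · exact min_le_left _ _
  have hαv : ∀ k, α k * pfeas k ≤ v k := fun k => by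
    rcases eq_or_ne (pfeas k) 0 with h0 | h0
    · rw [h0, mul_zero]; exact (hvpos k).le
    · have h1 : α k ≤ v k / pfeas k := by
        rw [hα, if_neg h0]; exact min_le_right _ _
      rwa [le_div_iff₀ (lt_of_le_of_ne (hpf0 k) h0.symm)] at h1
  have hzfun : ∀ k, z (k + 1)
      = fun i => z k i + α k * max (-(z k i) / β k) (g i (x (k + 1))) := fun k =>
    funext (hzupd k)
  have hz : ∀ k i, 0 ≤ z k i := by
    intro k
    induction k with
    | zero => exact hz0
    | succ k ih =>
      intro i
      have h1 : -(z k i) / β k ≤ max (-(z k i) / β k) (g i (x (k + 1))) := le_max_left _ _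
      have h2 : α k * (-(z k i) / β k) ≤ α k * max (-(z k i) / β k) (g i (x (k + 1))) :=
        mul_le_mul_of_nonneg_left h1 (hα0 k)
      have h3 : -(z k i) ≤ α k * (-(z k i) / β k) := by
        rw [mul_div_assoc', le_div_iff₀ (hβpos k)]
        linarith only [mul_le_mul_of_nonneg_left (hαβ k) (ih i)]
      rw [hzupd]
      linarith only [h2, h3]
  have hyrange : ∀ k, ∃ e, A e = y k := by
    intro k
    induction k with
    | zero => exact hy0
    | succ k ih =>
      obtain ⟨e, he⟩ := ih
      exact ⟨e + α k • (x (k + 1) - xfeas), by rw [hyupd]; simp [he, hAxfeas]⟩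
  set p : ℕ → WithLp 2 (EuclideanSpace ℝ (Fin n) × EuclideanSpace ℝ (Fin m)) :=
    fun k => multiplierPair (y k) (z k) with hpdef
  set q : ℕ → WithLp 2 (EuclideanSpace ℝ (Fin n) × EuclideanSpace ℝ (Fin m)) :=
    fun k => multiplierPair (A (x (k + 1)) - b)
      fun i => max (-(z k i) / β k) (g i (x (k + 1))) with hqdef
  have hpsucc : ∀ k, p (k + 1) = p k + α k • q k := fun k => by
    simp only [hpdef, hqdef]
    rw [hyupd, hzfun, multiplierPair_add_smul]
  -- uniform bound on the multipliers
  have hbound : ∀ B, ‖p 0‖ ≤ B → (∀ k, ‖p k‖ ≤ B → ‖p k + β k • q k‖ ≤ B) →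
      ∀ k, ‖p k‖ ≤ B := by
    intro B hB₀ hBstep k
    induction k with
    | zero => exact hB₀
    | succ k ih =>
      have hβk := hβpos k
      have h1 : p (k + 1) = (1 - α k / β k) • p k + (α k / β k) • (p k + β k • q k) := by
        rw [hpsucc, smul_add, smul_smul, div_mul_cancel₀ _ hβk.ne']
        module
      have h2 : α k / β k ≤ 1 := (div_le_one hβk).2 (hαβ k)
      have h3 : 0 ≤ α k / β k := div_nonneg (hα0 k) hβk.le
      rw [h1]
      refine (norm_add_le _ _).trans ?_
      rw [norm_smul, norm_smul, Real.norm_of_nonneg h3, Real.norm_of_nonneg (sub_nonneg.2 h2)]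
      linarith only [mul_le_mul_of_nonneg_left ih (sub_nonneg.2 h2),
        mul_le_mul_of_nonneg_left (hBstep k ih) h3]
  have htest : ∀ k, ∀ ω, ‖w k‖ ≤ ω → ∀ u ∈ X,
      ⟪y k + β k • (A (x (k + 1)) - b), A (x (k + 1) - u)⟫
        + ∑ i, max (z k i + β k * g i (x (k + 1))) 0 * (g i (x (k + 1)) - g i u)
      ≤ ω * D + Q := fun k ω hω u hu => by
    rw [hQ]
    exact stationarity_test hXconv hρ A (fun i => le_max_right _ _) (hxX _) hu (hxX k) hDle
      (hfdiffX _ (hxX _)) (hfgradbd _ (hxX _)) (hhsub _ (hxX _) _ (hξh k))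
      (hglin _ (hxX _) u hu) (hξf k) (hw k) hω
  have hgfeas : ∀ i, g i xfeas ≤ -gmin := fun i => by linarith only [hgmin.2 ⟨i, rfl⟩]
  have hxfX : xfeas ∈ X := interior_subset hxfeas
  have hp0Bp : ‖p 0‖ ≤ Bp := by
    rw [hpdef, multiplierPair_norm, hBp, hB0]; exact le_max_left _ _
  have hyhrange : ∀ k, ∃ e, A e = y k + β k • (A (x (k + 1)) - b) := fun k => by
    obtain ⟨e, he⟩ := hyrange k
    exact ⟨e + β k • (x (k + 1) - xfeas), by simp [he, hAxfeas]⟩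
  obtain ⟨B, hBCp, hB₀, hBstep⟩ : ∃ B, 3 * B ≤ Cp ∧ ‖p 0‖ ≤ B ∧
      ∀ k, ‖p k‖ ≤ B → ‖p k + β k • q k‖ ≤ B := by
    by_cases hA : A = 0
    · refine ⟨max Bp (7 / 6 * (Q / gmin)), ?_, hp0Bp.trans (le_max_left _ _), fun k hk => ?_⟩
      · rcases max_cases Bp (7 / 6 * (Q / gmin)) with ⟨h1, -⟩ | ⟨h1, -⟩ <;> rw [h1] <;> linarith only [hCpBp, hBp0, hQg]
      · refine multiplier_update_norm_le (X := X) (xs := xfeas) (τ := 0) (γ := gmin) (hβpos k)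
          le_rfl hgminpos le_rfl hAxfeas ?_ ?_ (htest k (ρ * D / 3) ?_) ?_ hk
        · intro u hu
          have : u = xfeas := by
            rw [← sub_eq_zero, ← norm_le_zero_iff]; exact hu
          rw [this]
          exact ⟨hxfX, hgfeas⟩
        · obtain ⟨e, he⟩ := hyhrange k
          rw [← he, hA]
          simp
        · linarith only [hwε k, hερ]
        · have h1 : 7 / 6 * (Q / gmin) ≤ max Bp (7 / 6 * (Q / gmin)) := le_max_right _ _
          have h2 := mul_le_mul_of_nonneg_left h1 hgminpos.le
          have h3 : gmin * (7 / 6 * (Q / gmin)) = 7 / 6 * Q := by field_simp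
          linarith only [h2, h3, hQρ, hερ, mul_le_mul_of_nonneg_right hερ.le hD0]
    · have hEnt : Nontrivial (EuclideanSpace ℝ (Fin d)) := by
        obtain ⟨e, he⟩ : ∃ e, A e ≠ 0 := by
          by_contra! h
          exact hA (ContinuousLinearMap.ext h)
        exact ⟨e, 0, fun h => he (by rw [h, map_zero])⟩
      obtain ⟨hdist, hballX⟩ := closedBall_infDist_frontier_subset hXcomp hxfeas
      obtain ⟨hl, hlA⟩ := sqrt_sInf_pos_eigenvalues_mul_norm_le hA hlamm
      have hm1 : 1 ≤ Real.sqrt m := by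
        rw [Real.one_le_sqrt]
        exact_mod_cast hm
      have hτ0 : 0 < τ := by
        rw [hτ]; exact lt_min (by positivity) hdist
      have hκ0 : 0 < min (τ * Real.sqrt lamm) (gmin / 2) :=
        lt_min (mul_pos hτ0 (Real.sqrt_pos.2 hl)) (by positivity)
      refine ⟨8 / 7 * Bp, by linarith only [hCpBp, hBp0, hQg], by linarith only [hp0Bp, hBp0], fun k hk => ?_⟩
      refine multiplier_update_norm_le (X := X) (xs := xfeas) (τ := τ) (γ := gmin / 2) (hβpos k)
          hτ0.le hκ0 (min_le_right _ _) hAxfeas ?_ ?_ (htest k _ (hw1 k)) ?_ hk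
      · intro u hu
        have huX : u ∈ X := by
          refine hballX ?_
          rw [mem_closedBall, dist_eq_norm]
          exact hu.trans (hτ ▸ min_le_right _ _)
        refine ⟨huX, fun i => ?_⟩
        have h1 := (abs_le.1 (hglip i u huX xfeas hxfX)).2
        have h2 : Bg * ‖u - xfeas‖ ≤ gmin / 2 := by
          have h3 : ‖u - xfeas‖ ≤ gmin / (2 * Real.sqrt m * Bg) :=
            hu.trans (hτ ▸ min_le_left _ _)
          rw [le_div_iff₀ (by positivity)] at h3
          have h4 : 0 ≤ Bg * ‖u - xfeas‖ := by positivity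
          nlinarith only [h3, h4, hm1]
        linarith only [hgfeas i, h1, h2]
      · obtain ⟨e, he⟩ := hyhrange k
        rw [← he]
        calc _ ≤ τ * Real.sqrt lamm * ‖A e‖ :=
              mul_le_mul_of_nonneg_right (min_le_left _ _) (norm_nonneg _)
          _ = τ * (Real.sqrt lamm * ‖A e‖) := by ring
          _ ≤ _ := mul_le_mul_of_nonneg_left (hlA e) hτ0.le
      · have h1 : θ ≤ Bp := by rw [hBp, hB0]; exact le_max_right _ _
        rw [hθ, div_le_iff₀ hκ0] at h1
        have h2 : Q + D ≤ Bbar := by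
          have h3 : 0 ≤ τ * (1 + rh + Bf + 2 * ρ * D) := by positivity
          rw [hBbar, hQ]
          nlinarith only [h3]
        linarith only [h1, h2, hQ0]
  have hpB := hbound B hB₀ hBstep
  have hB0' : 0 ≤ B := (norm_nonneg _).trans hB₀
  have hqB : ∀ k, β k * ‖q k‖ ≤ 2 * B := fun k => by
    have h1 : β k • q k = (p k + β k • q k) - p k := by abel
    have h2 := norm_sub_le (p k + β k • q k) (p k)
    rw [← h1, norm_smul, Real.norm_of_nonneg (hβpos k).le] at h2
    linarith only [h2, hpB k, hBstep k (hpB k)]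
  -- the potential
  have hβ₀le : ∀ k, 1 / β k ≤ 1 / β₀ := fun k => by
    refine one_div_le_one_div_of_le hβ₀ ?_
    have h1 := hβmono (Nat.zero_le k)
    rw [hβch 0] at h1
    simpa using h1
  have hβinv0 : ∀ k, 0 ≤ 1 / β k := fun k => one_div_nonneg.2 (hβpos k).le
  obtain ⟨S, hS0, hS4, hS01, hSstep⟩ := exists_logPotential
  have hvβ : ∀ k, v k / β k ≤ v₀ / β₀ * (S k - S (k + 1)) := by
    intro k
    rcases Nat.eq_zero_or_pos k with rfl | hk
    · rw [hvch0, hβch 0]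
      simp only [Nat.cast_zero, zero_add, Real.sqrt_one, mul_one]
      nlinarith only [hS01, hv₀β₀]
    · have hk' : (0 : ℝ) < (k : ℝ) + 1 := by positivity
      refine le_trans (le_of_eq ?_) (mul_le_mul_of_nonneg_left (hSstep k hk) hv₀β₀.le)
      rw [hvch k hk, hβch k]
      have key : ∀ s r L : ℝ, r = s * s →
          v₀ / (s * L ^ 2) / (β₀ * s) = v₀ / β₀ * (1 / (r * L ^ 2)) := by
        rintro s _ L rfl
        rw [div_div, div_mul_div_comm, mul_one]
        congr 1
        ring
      exact key _ _ _ (Real.mul_self_sqrt hk'.le).symm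
  have hZ : ∀ k, ∑ i, z k i ^ 2 ≤ B ^ 2 := fun k => by
    have h1 := pow_le_pow_left₀ (norm_nonneg _) (hpB k) 2
    rw [hpdef, multiplierPair_norm_sq] at h1
    linarith only [h1, sq_nonneg ‖y k‖]
  have hZ0 : ∀ k, 0 ≤ ∑ i, z k i ^ 2 := fun k => Finset.sum_nonneg fun i _ => sq_nonneg _
  set a : ℕ → ℝ := fun k =>
    f (x k) + h (x k) + augTerm (β k) (y k) (z k) (A (x k) - b) fun i => g i (x k) with hadef
  set c : ℕ → ℝ := fun k => f (x (k + 1)) + h (x (k + 1))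
    + augTerm (β k) (y k) (z k) (A (x (k + 1)) - b) fun i => g i (x (k + 1)) with hcdef
  set G : ℕ → ℝ := fun k => (∑ i, z k i ^ 2) * (1 / β k) + 4 * B * (v₀ / β₀) * S k
    + 3 * B ^ 2 * (1 / β k) with hGdef
  have htotal := sum_range_sub_le_of_potential (a := a) (c := c) (G := G)
    (M := Fmax + B ^ 2 / (2 * β₀)) (I := I)
    (Γ := 4 * (B ^ 2 * (1 / β₀)) + 16 * B * (v₀ / β₀)) ?_ ?_ ?_ ?_ hI0 ?_ Kt1 (K₂ - 1)
  · rw [Nat.sub_add_cancel hK₂pos] at htotal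
    have hdesc : ∀ j ∈ Finset.range K₂, 3 / 14 * (ε ^ 2 / ρ) ≤ a (Kt1 + j) - c (Kt1 + j) := by
      intro j hj
      have hj' := Finset.mem_range.1 hj
      have h1 := hlong (Kt1 + j) (by omega) (by omega)
      have h2 := augmented_descent (hβpos (Kt1 + j)) A b (y (Kt1 + j)) (z (Kt1 + j))
        (hxX (Kt1 + j)) (hglin _ (hxX (Kt1 + j + 1)) _ (hxX (Kt1 + j))) (hξf (Kt1 + j))
        (hξh (Kt1 + j)) (hw (Kt1 + j))
      refine le_trans ?_ h2
      set t := ‖x (Kt1 + j + 1) - x (Kt1 + j)‖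
      have ht0 : 0 ≤ t := norm_nonneg _
      have h3 := mul_le_mul_of_nonneg_right (hwε (Kt1 + j)) ht0
      have h4 : 3 / 14 * (ε ^ 2 / ρ) ≤ 3 * ρ / 2 * t ^ 2 - ε / 7 * t := by
        rw [mul_div_assoc', div_le_iff₀ hρ]
        nlinarith only [h1, ht0, hρ, hεpos]
      linarith only [h3, h4]
    have hsum := Finset.card_nsmul_le_sum _ _ _ hdesc
    rw [Finset.card_range, nsmul_eq_mul] at hsum
    have hceil : 5 * Cx * ρ / ε ^ 2 ≤ K₂ := by rw [hK₂]; exact Nat.le_ceil _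
    have h1 : 15 / 14 * Cx ≤ K₂ * (3 / 14 * (ε ^ 2 / ρ)) := by
      refine le_trans (le_of_eq ?_) (mul_le_mul_of_nonneg_right hceil (by positivity))
      field_simp
      norm_num
    have h2 : 9 * (B ^ 2 * (1 / β₀)) ≤ Cp ^ 2 / β₀ := by
      rw [show 9 * (B ^ 2 * (1 / β₀)) = 9 * B ^ 2 / β₀ by ring]
      refine div_le_div_of_nonneg_right ?_ hβ₀.le
      nlinarith only [hBCp, hB0']
    have h3 : 3 * B * (v₀ / β₀) ≤ Cp * (v₀ / β₀) := mul_le_mul_of_nonneg_right hBCp hv₀β₀.le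
    have h4 : B ^ 2 / (2 * β₀) = B ^ 2 * (1 / β₀) / 2 := by ring
    have h5 : 0 ≤ B ^ 2 * (1 / β₀) := by positivity
    have h6 : 0 ≤ B * (v₀ / β₀) := by positivity
    linarith only [htotal, hsum, h1, h2, h3, h4, h5, h6, hCxlow, hCx0, hI0]
  · intro k
    have := hZ0 k
    have := hS0 k
    have := hβinv0 k
    positivity
  · intro k
    have h1 : (∑ i, z k i ^ 2) * (1 / β k) ≤ B ^ 2 * (1 / β₀) :=
      mul_le_mul (hZ k) (hβ₀le k) (hβinv0 k) (sq_nonneg _)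
    have h2 : 4 * B * (v₀ / β₀) * S k ≤ 4 * B * (v₀ / β₀) * 4 :=
      mul_le_mul_of_nonneg_left (hS4 k) (by positivity)
    have h3 : 3 * B ^ 2 * (1 / β k) ≤ 3 * B ^ 2 * (1 / β₀) :=
      mul_le_mul_of_nonneg_left (hβ₀le k) (by positivity)
    simp only [hGdef]
    linarith only [h1, h2, h3]
  · intro k
    refine (abs_add_le _ _).trans (add_le_add (hFmax.2 ⟨_, hxX (k + 1), rfl⟩) ?_)
    refine (abs_augTerm_le (hβpos k) (hpB k) (hBstep k (hpB k))).trans ?_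
    have h1 : B ^ 2 / (2 * β k) = B ^ 2 / 2 * (1 / β k) := by ring
    have h2 : B ^ 2 / (2 * β₀) = B ^ 2 / 2 * (1 / β₀) := by ring
    rw [h1, h2]
    exact mul_le_mul_of_nonneg_left (hβ₀le k) (by positivity)
  · have h1 : |f (x 0) + h (x 0)| ≤ Fmax := hFmax.2 ⟨_, hx0, rfl⟩
    have h2 : β 0 = β₀ := by rw [hβch 0]; simp
    have h3 : 0 ≤ (∑ i, z 0 i ^ 2) / (2 * β₀) := div_nonneg (hZ0 0) (by positivity)
    have h4 : 0 ≤ B ^ 2 / (2 * β₀) := by positivity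
    simp only [hadef, augTerm, h2, hI]
    linarith only [h1, h3, h4, le_abs_self (f (x 0) + h (x 0)), le_abs_self ⟪y 0, A (x 0) - b⟫]
  · intro k
    have hβk := hβpos k
    have hdamp : α k * Real.sqrt (‖A (x (k + 1)) - b‖ ^ 2
        + ∑ i, max (g i (x (k + 1))) 0 ^ 2) ≤ v k := by
      rw [← hpfeas]; exact hαv k
    have hp' := hpB (k + 1)
    simp only [hpdef] at hp'
    rw [hyupd, hzfun] at hp'
    have h1 := damped_mul_norm_sq_le (hα0 k) hβk (hαβ k) (hz k) (hvpos k).le hdamp (hpB k) hp'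
      (hqB k)
    have h2 := augTerm_update_le (α := α k) hβk (hβpos (k + 1)) (y k) (A (x (k + 1)) - b) (z k)
      fun i => g i (x (k + 1))
    rw [← hyupd, ← hzfun] at h2
    have h3 : ∑ i, (z k i + α k * max (-(z k i) / β k) (g i (x (k + 1)))) ^ 2
        = ∑ i, z (k + 1) i ^ 2 := by rw [hzfun]
    rw [h3] at h1
    have h4 : (β (k + 1) - β k) / 2 * ‖q k‖ ^ 2
        ≤ 3 * B ^ 2 * (1 / β k) - 3 * B ^ 2 * (1 / β (k + 1)) := by
      have h5 : ‖q k‖ ^ 2 ≤ B ^ 2 * (4 / β k ^ 2) := by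
        have h6 := pow_le_pow_left₀ (by positivity) (hqB k) 2
        rw [mul_div_assoc', le_div_iff₀ (by positivity)]
        linarith only [h6]
      have h7 : 0 ≤ (β (k + 1) - β k) / 2 := by linarith only [hβmono (Nat.le_succ k)]
      have h8 := sqrt_growth hβ₀ k
      rw [← hβch, ← hβch] at h8
      have h9 := mul_le_mul_of_nonneg_left h5 h7
      have h10 := mul_le_mul_of_nonneg_left h8 (sq_nonneg B)
      linarith only [h9, h10]
    have h11 : (∑ i, z (k + 1) i ^ 2) * (1 / β (k + 1)) ≤ (∑ i, z (k + 1) i ^ 2) * (1 / β k) :=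
      mul_le_mul_of_nonneg_left (one_div_le_one_div_of_le hβk (hβmono (Nat.le_succ k)))
        (hZ0 _)
    have h12 := mul_le_mul_of_nonneg_left (hvβ k) (show 0 ≤ 4 * B by positivity)
    have h13 : (∑ i, z k i ^ 2 - ∑ i, z (k + 1) i ^ 2) / β k
        = (∑ i, z k i ^ 2) * (1 / β k) - (∑ i, z (k + 1) i ^ 2) * (1 / β k) := by ring
    simp only [hadef, hcdef, hGdef]
    rw [h13] at h1
    linarith only [h1, h2, h4, h11, h12]
end
end
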